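/- arXiv:1506.07052 — 4 statements merged into one kernel-verified Lean document; each statement's English description precedes it below -/
import Mathlib

section
/- Let R be a commutative noetherian ring and a ⊊ R a proper ideal. If R_p is Gorenstein for every prime p of R (i.e., R is locally Gorenstein), then the a-adic completion R̂ is locally Gorenstein: R̂_M is Gorenstein for every maximal ideal M of R̂. -/
open CategoryTheory

noncomputable section
universe u

/-- A noetherian local ring `A` is Gorenstein if `Ext^i_A(k, A)` vanishes for `i ≠ d` and is
isomorphic to the residue field `k` for `i = d` (for some `d`). -/
def IsGorensteinLocalRing (A : Type u) [CommRing A] [IsLocalRing A] : Prop :=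
  ∃ d : ℕ,
    (∀ i : ℕ, i ≠ d → Subsingleton (((Ext A (ModuleCat.{u} A) i).obj
      (Opposite.op (ModuleCat.of A (IsLocalRing.ResidueField A)))).obj (ModuleCat.of A A))) ∧
    Nonempty ((((Ext A (ModuleCat.{u} A) d).obj
      (Opposite.op (ModuleCat.of A (IsLocalRing.ResidueField A)))).obj (ModuleCat.of A A))
      ≃ₗ[A] IsLocalRing.ResidueField A)

section Aux
open Limits TensorProduct IsLocalRing

theorem aux_maximal {R : Type*} [CommRing R] [IsNoetherianRing R] (a : Ideal R)
   (M : Ideal (AdicCompletion a R)) (hM : M.IsMaximal) :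
    (M.comap (algebraMap R (AdicCompletion a R))).map (algebraMap R (AdicCompletion a R)) = M := by
  have fg := a.fg_of_isNoetherianRing
  have := AdicCompletion.isAdicComplete_self a fg
  have h1 : a.map (algebraMap R (AdicCompletion a R)) ≤ M :=
    (IsAdicComplete.le_jacobson_bot _).trans <| sInf_le ⟨bot_le, hM⟩
  have hk := AdicCompletion.ker_evalOneₐ_eq_map a fg
  have hs := AdicCompletion.evalOneₐ_surjective a
  have hmax : (M.map (AdicCompletion.evalOneₐ a).toRingHom).IsMaximal :=
    Ideal.IsMaximal.map_of_surjective_of_ker_le hs (hk.le.trans h1)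
  have e : M.comap (algebraMap R (AdicCompletion a R)) =
      (M.map (AdicCompletion.evalOneₐ a).toRingHom).comap (Ideal.Quotient.mk a) := by
    rw [← AdicCompletion.evalOneₐ_comp_algebraMap_eq_mk, ← Ideal.comap_comap,
      Ideal.comap_map_of_surjective' (AdicCompletion.evalOneₐ a).toRingHom hs, hk, sup_eq_left.2 h1]
  have hm : (M.comap (algebraMap R (AdicCompletion a R))).IsMaximal := by
    rw [e]; exact Ideal.comap_isMaximal_of_surjective _ Ideal.Quotient.mk_surjective
  have := AdicCompletion.isMaximal_map_of_le a _ (Ideal.map_le_iff_le_comap.1 h1) fg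
  exact this.eq_of_le hM.ne_top Ideal.map_comap_le

theorem aux_maxloc {R S : Type*} [CommRing R] [CommRing S] [Algebra R S]
   (p : Ideal R) [p.IsPrime] (M : Ideal S) [M.IsPrime] [M.LiesOver p]
   [Algebra (Localization.AtPrime p) (Localization.AtPrime M)]
    [Localization.AtPrime.IsLiesOverAlgebra p M] (h : p.map (algebraMap R S) = M) :
   (maximalIdeal (Localization.AtPrime p)).map (algebraMap (Localization.AtPrime p) (Localization.AtPrime M))
     = maximalIdeal (Localization.AtPrime M) := by
  rw [← Localization.AtPrime.map_eq_maximalIdeal, ← Localization.AtPrime.map_eq_maximalIdeal,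
    Ideal.map_map, ← IsScalarTower.algebraMap_eq]
  conv_rhs => enter [2]; rw [← h]
  rw [Ideal.map_map, ← IsScalarTower.algebraMap_eq]

theorem aux_res {A B : Type*} [CommRing A] [CommRing B] [IsLocalRing A] [IsLocalRing B] [Algebra A B]
   (h : (maximalIdeal A).map (algebraMap A B) = maximalIdeal B) :
   Nonempty (B ⊗[A] ResidueField A ≃ₗ[B] ResidueField B) := by
  exact ⟨((Algebra.TensorProduct.quotIdealMapEquivTensorQuot B (maximalIdeal A)).symm.toLinearEquiv).trans
    (Submodule.quotEquivOfEq _ _ h)⟩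

section BaseChange
variable (A B : Type u) [CommRing A] [CommRing B] [Algebra A B]

/-- base change functor -/
def bcFunctor : ModuleCat.{u} A ⥤ ModuleCat.{u} B where
  obj M := ModuleCat.of B (B ⊗[A] M)
  map f := ModuleCat.ofHom (f.hom.baseChange B)
  map_id M := by ext : 1; simp
  map_comp f g := by ext : 1; simp [LinearMap.baseChange_comp]

instance : (bcFunctor A B).Additive where
  map_add {X Y f g} := by
    ext : 1
    exact LinearMap.baseChange_add f.hom g.hom

instance : (bcFunctor A B).PreservesProjectiveObjects where
  projective_obj {P} hP := by
    have : Module.Projective A P := (IsProjective.iff_projective P).2 hP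
    exact (IsProjective.iff_projective (R := B) (B ⊗[A] P)).1 inferInstance

theorem bcFunctor_exact [Module.Flat A B] (S : ShortComplex (ModuleCat.{u} A)) (h : S.Exact) :
    (S.map (bcFunctor A B)).Exact := by
  rw [CategoryTheory.ShortComplex.ShortExact.moduleCat_exact_iff_function_exact] at h ⊢
  exact Module.Flat.lTensor_exact B h

instance [Module.Flat A B] : (bcFunctor A B).PreservesHomology := by
  have := ((CategoryTheory.Functor.exact_tfae (bcFunctor A B)).out 1 2).mp
    (bcFunctor_exact A B)
  exact this

/-- Hom base change -/
def homBC [Module.Flat A B] (M N : ModuleCat.{u} A) [Module.FinitePresentation A M] :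
    (bcFunctor A B).obj (ModuleCat.of A (M ⟶ N)) ≅
     ModuleCat.of B ((bcFunctor A B).obj M ⟶ (bcFunctor A B).obj N) :=
  LinearEquiv.toModuleIso (
    ((ModuleCat.homLinearEquiv (S := A) (M := M) (N := N)).baseChange A B).trans <|
    (Module.FinitePresentation.isBaseChange_map A M N B).equiv.trans
    (ModuleCat.homLinearEquiv (S := B) (M := (bcFunctor A B).obj M) (N := (bcFunctor A B).obj N)).symm)

lemma homBC_tmul [Module.Flat A B] (M N : ModuleCat.{u} A) [Module.FinitePresentation A M] (b : B) (f : M ⟶ N) :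
   (homBC A B M N).hom.hom (b ⊗ₜ f) = b • (bcFunctor A B).map f := by
  simp [homBC, bcFunctor]
  rfl

lemma bc_ext {X : ModuleCat.{u} A} {Y : ModuleCat.{u} B} (f g : (bcFunctor A B).obj X ⟶ Y)
    (h : ∀ (b : B) (x : X), f.hom (b ⊗ₜ[A] x : B ⊗[A] X) = g.hom (b ⊗ₜ[A] x : B ⊗[A] X)) :
    f = g := by
  apply ModuleCat.hom_ext
  refine LinearMap.ext fun x ↦ ?_
  have hz : ∀ z : B ⊗[A] X, f.hom z = g.hom z := by
    intro z
    induction z using TensorProduct.induction_on with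
    | zero => exact (map_zero f.hom).trans (map_zero g.hom).symm
    | tmul b x => exact h b x
    | add x y hx hy =>
      exact (map_add f.hom _ _).trans ((congrArg₂ _ hx hy).trans (map_add g.hom _ _).symm)
  exact hz x

lemma homBC_nat [Module.Flat A B] {M M' : ModuleCat.{u} A} (N : ModuleCat.{u} A)
    [Module.FinitePresentation A M] [Module.FinitePresentation A M'] (g : M' ⟶ M) :
    (bcFunctor A B).map (ModuleCat.ofHom (Linear.leftComp A N g)) ≫ (homBC A B M' N).hom =
    (homBC A B M N).hom ≫
      ModuleCat.ofHom (Linear.leftComp B ((bcFunctor A B).obj N) ((bcFunctor A B).map g)) := by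
  apply bc_ext
  intro b f
  refine (homBC_tmul A B M' N b (g ≫ f)).trans ?_
  refine Eq.trans ?_ (congrArg (fun t ↦ (bcFunctor A B).map g ≫ t) (homBC_tmul A B M N b f)).symm
  rw [Functor.map_comp]
  exact (Linear.comp_smul _ _ _ _ _ _).symm

section
variable [IsNoetherianRing A]

instance : (forget₂ (FGModuleCat.{u} A) (ModuleCat.{u} A)).PreservesHomology := inferInstance

def fgFree (n : ℕ) : FGModuleCat.{u} A := FGModuleCat.of A (Fin n → A)

instance (n : ℕ) : Projective (fgFree A n) where
  factors {E X} f e he := by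
    have h1 : Epi ((forget₂ (FGModuleCat.{u} A) (ModuleCat.{u} A)).map e) := inferInstance
    let F := forget₂ (FGModuleCat.{u} A) (ModuleCat.{u} A)
    have : Projective (F.obj (fgFree A n)) := (IsProjective.iff_projective (R := A) (Fin n → A)).1 inferInstance
    obtain ⟨g, hg⟩ := Projective.factors (P := F.obj (fgFree A n)) (F.map f) (F.map e)
    refine ⟨F.preimage g, ?_⟩
    apply F.map_injective
    rw [F.map_comp, F.map_preimage, hg]

theorem exists_fgFree (X : FGModuleCat.{u} A) : ∃ (n : ℕ) (f : fgFree A n ⟶ X), Epi f := by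
  obtain ⟨n, f, hf⟩ := Module.Finite.exists_fin' A X.obj
  let F := forget₂ (FGModuleCat.{u} A) (ModuleCat.{u} A)
  let g : F.obj (fgFree A n) ⟶ F.obj X := ModuleCat.ofHom f
  have hg : Epi g := (ModuleCat.epi_iff_surjective _).2 hf
  refine ⟨n, F.preimage g, ?_⟩
  apply F.epi_of_epi_map
  rw [F.map_preimage]
  exact hg

instance : EnoughProjectives (FGModuleCat.{u} A) where
  presentation X := by
    obtain ⟨n, f, hf⟩ := exists_fgFree A X
    exact ⟨{ p := fgFree A n, f := f, projective := inferInstance, epi := hf }⟩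

instance : (forget₂ (FGModuleCat.{u} A) (ModuleCat.{u} A)).PreservesProjectiveObjects where
  projective_obj {P} hP := by
    obtain ⟨n, f, hf⟩ := exists_fgFree A P
    let F := forget₂ (FGModuleCat.{u} A) (ModuleCat.{u} A)
    have : Projective (F.obj (fgFree A n)) := (IsProjective.iff_projective (R := A) (Fin n → A)).1 inferInstance
    let r : Retract P (fgFree A n) := ⟨Projective.factorThru (𝟙 P) f, f, by simp⟩
    exact (r.map F).projective

/-- finite resolution -/
def finRes (X : FGModuleCat.{u} A) : ProjectiveResolution ((forget₂ (FGModuleCat.{u} A) (ModuleCat.{u} A)).obj X) :=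
  (forget₂ (FGModuleCat.{u} A) (ModuleCat.{u} A)).mapProjectiveResolution (ProjectiveResolution.of X)

instance (X : FGModuleCat.{u} A) (n : ℕ) : Module.FinitePresentation A ((finRes A X).complex.X n) := by
  have : Module.Finite A ((finRes A X).complex.X n) := ((ProjectiveResolution.of X).complex.X n).property
  exact Module.finitePresentation_of_finite A _

variable [Module.Flat A B]
def complexIso (P : ChainComplex (ModuleCat.{u} A) ℕ) [∀ n, Module.FinitePresentation A (P.X n)] (N : ModuleCat.{u} A) :
    ((bcFunctor A B).mapHomologicalComplex _).obj (P.linearYonedaObj A N) ≅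
    ChainComplex.linearYonedaObj (((bcFunctor A B).mapHomologicalComplex _).obj P) B ((bcFunctor A B).obj N) :=
  HomologicalComplex.Hom.isoOfComponents (fun n ↦ homBC A B (P.X n) N) (by
    intro i j hij
    exact (homBC_nat A B N (P.d j i)).symm)

def extBC (X : FGModuleCat.{u} A) (N : ModuleCat.{u} A) (n : ℕ) :
  ((Ext B (ModuleCat.{u} B) n).obj
      (Opposite.op ((bcFunctor A B).obj ((forget₂ (FGModuleCat.{u} A) (ModuleCat.{u} A)).obj X)))).obj ((bcFunctor A B).obj N) ≅
   (bcFunctor A B).obj (((Ext A (ModuleCat.{u} A) n).obj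
      (Opposite.op ((forget₂ (FGModuleCat.{u} A) (ModuleCat.{u} A)).obj X))).obj N) :=
  (((bcFunctor A B).mapProjectiveResolution (finRes A X)).isoExt n _) ≪≫
  (HomologicalComplex.homologyMapIso (complexIso A B (finRes A X).complex N).symm n) ≪≫
  ShortComplex.mapHomologyIso (((finRes A X).complex.linearYonedaObj A N).sc n) (bcFunctor A B) ≪≫
  (bcFunctor A B).mapIso ((finRes A X).isoExt n N).symm

theorem gor_of_flat [IsLocalRing A] [IsLocalRing B]
    (h : (maximalIdeal A).map (algebraMap A B) = maximalIdeal B)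
    (hA : IsGorensteinLocalRing A) : IsGorensteinLocalRing B := by
  obtain ⟨d, h0, ⟨e⟩⟩ := hA
  obtain ⟨r⟩ := aux_res (A := A) (B := B) h
  let X : FGModuleCat.{u} A := FGModuleCat.of A (ResidueField A)
  let i1 : (bcFunctor A B).obj (ModuleCat.of A (ResidueField A)) ≅
    ModuleCat.of B (ResidueField B) := r.toModuleIso
  let i2 : (bcFunctor A B).obj (ModuleCat.of A A) ≅ ModuleCat.of B B :=
    (TensorProduct.AlgebraTensorModule.rid A B B).toModuleIso
  have key (n : ℕ) : Nonempty (((Ext B (ModuleCat.{u} B) n).obj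
      (Opposite.op (ModuleCat.of B (ResidueField B)))).obj (ModuleCat.of B B) ≅
      (bcFunctor A B).obj (((Ext A (ModuleCat.{u} A) n).obj
      (Opposite.op (ModuleCat.of A (ResidueField A)))).obj (ModuleCat.of A A))) :=
    ⟨((Ext B (ModuleCat.{u} B) n).mapIso i1.op).app _ ≪≫
      (((Ext B (ModuleCat.{u} B) n).obj _).mapIso i2).symm ≪≫
      extBC A B X (ModuleCat.of A A) n⟩
  refine ⟨d, fun i hi ↦ ?_, ?_⟩
  · obtain ⟨k⟩ := key i
    have := h0 i hi
    have h2 : Subsingleton (B ⊗[A] (((Ext A (ModuleCat.{u} A) i).obj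
      (Opposite.op (ModuleCat.of A (ResidueField A)))).obj (ModuleCat.of A A))) := inferInstance
    exact (k.toLinearEquiv.toEquiv.subsingleton_congr).2 h2
  · obtain ⟨k⟩ := key d
    exact ⟨k.toLinearEquiv.trans ((e.baseChange A B).trans r)⟩
end

end BaseChange
end Aux

/-- If `R` is a locally Gorenstein commutative noetherian ring and `a ⊊ R` is a proper ideal,
then the `a`-adic completion `R̂` is locally Gorenstein: `R̂_M` is Gorenstein for every maximal
ideal `M` of `R̂`. -/
theorem adicCompletion_locallyGorenstein
    (R : Type u) [CommRing R] [IsNoetherianRing R] (a : Ideal R) (ha : a ≠ ⊤)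
    (hR : ∀ (p : Ideal R) (hp : p.IsPrime),
      letI := hp
      IsGorensteinLocalRing (Localization.AtPrime p)) :
    ∀ (M : Ideal (AdicCompletion a R)) (hM : M.IsMaximal),
      letI := hM.isPrime
      IsGorensteinLocalRing (Localization.AtPrime M) := by
  intro M hM
  have := hM.isPrime
  let p := M.comap (algebraMap R (AdicCompletion a R))
  have hp : p.IsPrime := inferInstance
  have hl : M.LiesOver p := ⟨rfl⟩
  letI : Algebra (Localization.AtPrime p) (Localization.AtPrime M) :=
    Localization.AtPrime.algebraOfLiesOver p M
  exact gor_of_flat (Localization.AtPrime p) (Localization.AtPrime M)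
    (aux_maxloc p M (aux_maximal a M hM)) (hR p hp)

end
end

section
/- Let (R, m, k) be a local noetherian ring and E = E_R(k) the injective hull of the residue field. Then the homothety map R̂ → Hom_R(E, E), sending r ∈ R̂ to multiplication by r (using the natural R̂-module structure on the m-torsion module E), is an isomorphism, where R̂ is the m-adic completion. -/
noncomputable section
universe u

/-- `E` is an injective hull of the residue field `k` of a local ring `R`:  `E` is injective
and contains a copy of `k` as an essential submodule. -/
def IsInjectiveHullOfResidueField (R : Type u) [CommRing R] [IsLocalRing R]
    (E : Type u) [AddCommGroup E] [Module R E] : Prop :=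
  Module.Injective R E ∧
  ∃ f : IsLocalRing.ResidueField R →ₗ[R] E, Function.Injective f ∧
    ∀ N : Submodule R E, N ≠ ⊥ → N ⊓ LinearMap.range f ≠ ⊥

section MatlisHelpers

open IsLocalRing

variable {R : Type u} [CommRing R] [IsLocalRing R] {E : Type u} [AddCommGroup E] [Module R E]

theorem matlis_smul_range (f : ResidueField R →ₗ[R] E) {a : R} (ha : a ∈ maximalIdeal R)
    (c : ResidueField R) : a • f c = 0 := by
  have h : a • c = 0 := by
    rw [Algebra.smul_def]
    have : algebraMap R (ResidueField R) a = 0 := (residue_eq_zero_iff a).2 ha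
    rw [this, zero_mul]
  rw [← map_smul, h, map_zero]

theorem matlis_range_cyclic (f : ResidueField R →ₗ[R] E) {u v : E}
    (hu : u ∈ LinearMap.range f) (hu0 : u ≠ 0) (hv : v ∈ LinearMap.range f) :
    ∃ s : R, v = s • u := by
  obtain ⟨c, rfl⟩ := hu
  obtain ⟨d, rfl⟩ := hv
  have hc : c ≠ 0 := by rintro rfl; exact hu0 (map_zero f)
  obtain ⟨s, hs⟩ := residue_surjective (R := R) (d / c)
  refine ⟨s, ?_⟩
  rw [← map_smul, Algebra.smul_def]
  have : algebraMap R (ResidueField R) s = d / c := hs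
  rw [this, div_mul_cancel₀ _ hc]

/-- Essentiality, elementwise. -/
theorem matlis_ess (f : ResidueField R →ₗ[R] E)
    (hf : ∀ N : Submodule R E, N ≠ ⊥ → N ⊓ LinearMap.range f ≠ ⊥) {x : E} (hx : x ≠ 0) :
    ∃ r : R, r • x ≠ 0 ∧ r • x ∈ LinearMap.range f := by
  have h := hf (Submodule.span R {x}) (by simpa using hx)
  obtain ⟨y, hy, hy0⟩ := Submodule.exists_mem_ne_zero_of_ne_bot h
  obtain ⟨r, rfl⟩ := Submodule.mem_span_singleton.1 hy.1
  exact ⟨r, hy0, hy.2⟩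

theorem matlis_socle (f : ResidueField R →ₗ[R] E)
    (hf : ∀ N : Submodule R E, N ≠ ⊥ → N ⊓ LinearMap.range f ≠ ⊥) {x : E}
    (hx : ∀ a ∈ maximalIdeal R, a • x = 0) : x ∈ LinearMap.range f := by
  by_cases hx0 : x = 0
  · rw [hx0]; exact zero_mem _
  obtain ⟨r, hr0, hr⟩ := matlis_ess f hf hx0
  have hu : IsUnit r := by
    by_contra h
    exact hr0 (hx r ((mem_maximalIdeal r).2 h))
  obtain ⟨w, rfl⟩ := hu
  have := Submodule.smul_mem (LinearMap.range f) ((w⁻¹ : Rˣ) : R) hr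
  rwa [smul_smul, Units.inv_mul, one_smul] at this

theorem matlis_torsion [IsNoetherianRing R] (f : ResidueField R →ₗ[R] E)
    (hf : ∀ N : Submodule R E, N ≠ ⊥ → N ⊓ LinearMap.range f ≠ ⊥) (x : E) :
    ∃ n : ℕ, ∀ a ∈ maximalIdeal R ^ n, a • x = 0 := by
  have hrad : maximalIdeal R ≤
      Ideal.radical (LinearMap.ker (LinearMap.toSpanSingleton R E x) : Ideal R) := by
    intro a ha
    let J : ℕ →o Ideal R :=
      ⟨fun n => LinearMap.ker (LinearMap.toSpanSingleton R E (a ^ n • x)), by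
        refine monotone_nat_of_le_succ fun n b hb => ?_
        simp only [LinearMap.mem_ker, LinearMap.toSpanSingleton_apply] at hb ⊢
        rw [pow_succ', mul_smul, smul_comm, hb, smul_zero]⟩
    obtain ⟨n, hn⟩ := monotone_stabilizes_iff_noetherian.2
      (inferInstance : IsNoetherian R R) J
    refine ⟨n, ?_⟩
    rw [LinearMap.mem_ker, LinearMap.toSpanSingleton_apply]
    by_contra h0
    obtain ⟨r, hr0, c, hc⟩ := matlis_ess f hf h0
    have h1 : r ∈ J (n + 1) := by
      change r ∈ LinearMap.ker (LinearMap.toSpanSingleton R E (a ^ (n + 1) • x))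
      rw [LinearMap.mem_ker, LinearMap.toSpanSingleton_apply, pow_succ', mul_smul, smul_comm,
        ← hc]
      exact matlis_smul_range f ha c
    rw [← hn (n + 1) (Nat.le_succ n)] at h1
    exact hr0 h1
  obtain ⟨n, hn⟩ := Ideal.exists_pow_le_of_le_radical_of_fg hrad
    (IsNoetherian.noetherian (maximalIdeal R))
  exact ⟨n, fun a ha => by simpa using hn ha⟩

/-- `E` is a cogenerator for cyclic modules. -/
theorem matlis_cogen (hE : IsInjectiveHullOfResidueField R E) (I : Ideal R) (r : R)
    (h : ∀ x : E, (∀ a ∈ I, a • x = 0) → r • x = 0) : r ∈ I := by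
  obtain ⟨hinj, f, hfi, -⟩ := hE
  by_contra hr
  let g : R →ₗ[R] R ⧸ I := LinearMap.toSpanSingleton R (R ⧸ I) (Ideal.Quotient.mk I r)
  let q : R →ₗ[R] E := LinearMap.toSpanSingleton R E (f 1)
  have hg1 : g 1 ≠ 0 := by
    simpa [g, Ideal.Quotient.eq_zero_iff_mem] using hr
  have hker : LinearMap.ker g ≤ LinearMap.ker q := by
    intro a ha
    have ham : a ∈ maximalIdeal R := by
      rw [mem_maximalIdeal]
      intro hu
      obtain ⟨w, rfl⟩ := hu
      apply hg1
      have h2 : ((w⁻¹ : Rˣ) : R) • g (w : R) = 0 := by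
        rw [LinearMap.mem_ker.1 ha, smul_zero]
      rwa [← map_smul, smul_eq_mul, Units.inv_mul] at h2
    rw [LinearMap.mem_ker]
    exact matlis_smul_range f ham 1
  let g' : (R ⧸ LinearMap.ker g) →ₗ[R] R ⧸ I := (LinearMap.ker g).liftQ g le_rfl
  have hg' : Function.Injective g' := by
    rw [← LinearMap.ker_eq_bot]
    exact Submodule.ker_liftQ_eq_bot _ _ _ le_rfl
  obtain ⟨t, ht⟩ := hinj.out g' hg' ((LinearMap.ker g).liftQ q hker)
  have h1 := ht (Submodule.Quotient.mk 1)
  have e1 : g' (Submodule.Quotient.mk 1) = g 1 := Submodule.liftQ_apply _ _ _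
  have e2 : (LinearMap.ker g).liftQ q hker (Submodule.Quotient.mk 1) = q 1 :=
    Submodule.liftQ_apply _ _ _
  rw [e1, e2] at h1
  have h3 : q 1 = f 1 := by simp [q]
  have key : ∀ a : R, a • t 1 = t (Ideal.Quotient.mk I a) := by
    intro a
    rw [← map_smul, Algebra.smul_def, mul_one]
    rfl
  have h4 := h (t 1) (fun a ha => by
    rw [key, Ideal.Quotient.eq_zero_iff_mem.2 ha, map_zero])
  have h5 : g 1 = Ideal.Quotient.mk I r := by simp [g]
  rw [key, ← h5, h1, h3] at h4
  exact one_ne_zero (hfi (h4.trans (map_zero f).symm))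

/-- Endomorphisms act as scalars on `E[I]` for `I` containing a power of the maximal ideal. -/
theorem matlis_scalar [IsNoetherianRing R] (f : ResidueField R →ₗ[R] E)
    (hf : ∀ N : Submodule R E, N ≠ ⊥ → N ⊓ LinearMap.range f ≠ ⊥) (φ : E →ₗ[R] E)
    (n : ℕ) (I : Ideal R) : maximalIdeal R ^ n ≤ I →
      ∃ r : R, ∀ x : E, (∀ a ∈ I, a • x = 0) → φ x = r • x := by
  induction I using WellFoundedGT.induction with
  | ind I ih =>
  intro hI
  by_cases htop : I = ⊤
  · refine ⟨0, fun x hx => ?_⟩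
    have : x = 0 := by simpa using hx 1 (htop ▸ Submodule.mem_top)
    simp [this]
  classical
  have hex : ∃ k, maximalIdeal R ^ k ≤ I := ⟨n, hI⟩
  obtain ⟨a, haI, ham⟩ : ∃ a, a ∉ I ∧ ∀ b ∈ maximalIdeal R, b * a ∈ I := by
    rcases hk : Nat.find hex with _ | k
    · have := Nat.find_spec hex
      rw [hk, pow_zero, Ideal.one_eq_top, top_le_iff] at this
      exact absurd this htop
    · have h1 := Nat.find_spec hex
      have h2 := Nat.find_min hex (m := k) (by omega)
      rw [hk] at h1
      obtain ⟨a, ha, haI⟩ := SetLike.not_le_iff_exists.1 h2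
      exact ⟨a, haI, fun b hb => h1 (by rw [pow_succ']; exact Ideal.mul_mem_mul hb ha)⟩
  have hlt : I < I ⊔ Ideal.span {a} := by
    refine lt_of_le_of_ne le_sup_left fun h => haI ?_
    rw [h]
    exact Ideal.mem_sup_right (Ideal.mem_span_singleton_self a)
  obtain ⟨r, hr⟩ := ih _ hlt (hI.trans hlt.le)
  have hr' : ∀ x : E, (∀ b ∈ I, b • x = 0) → a • x = 0 → φ x = r • x := by
    intro x hx hax
    refine hr x fun b hb => ?_
    obtain ⟨b1, hb1, b2, hb2, rfl⟩ := Submodule.mem_sup.1 hb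
    obtain ⟨c, rfl⟩ := Ideal.mem_span_singleton'.1 hb2
    rw [add_smul, hx b1 hb1, mul_smul, hax, smul_zero, add_zero]
  by_cases hall : ∀ x : E, (∀ b ∈ I, b • x = 0) → a • x = 0
  · exact ⟨r, fun x hx => hr' x hx (hall x hx)⟩
  push Not at hall
  obtain ⟨x₀, hx₀, hax₀⟩ := hall
  have hsoc : ∀ x : E, (∀ b ∈ I, b • x = 0) → a • x ∈ LinearMap.range f := fun x hx =>
    matlis_socle f hf fun b hb => by rw [smul_smul]; exact hx _ (ham b hb)
  have hφ : φ x₀ - r • x₀ ∈ LinearMap.range f := by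
    refine matlis_socle f hf fun b hb => ?_
    have := hr' (b • x₀) (fun c hc => by rw [smul_comm, hx₀ c hc, smul_zero])
      (by rw [smul_smul, mul_comm]; exact hx₀ _ (ham b hb))
    rw [smul_sub, ← map_smul, this, smul_comm, sub_self]
  obtain ⟨s, hs⟩ := matlis_range_cyclic f (hsoc x₀ hx₀) hax₀ hφ
  refine ⟨r + s * a, fun x hx => ?_⟩
  obtain ⟨t, ht⟩ := matlis_range_cyclic f (hsoc x₀ hx₀) hax₀ (hsoc x hx)
  have h1 := hr' (x - t • x₀)
    (fun b hb => by rw [smul_sub, hx b hb, smul_comm, hx₀ b hb, smul_zero, sub_zero])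
    (by rw [smul_sub, ht, smul_comm, sub_self])
  rw [map_sub, map_smul, sub_eq_iff_eq_add, eq_add_of_sub_eq hs] at h1
  rw [h1, add_smul, mul_smul, ht, smul_sub, smul_add, smul_comm t r x₀, smul_comm t s]
  abel

theorem matlis_compat (I : Ideal R) (z : AdicCompletion I R) {n n' : ℕ} (h : n ≤ n') {c c' : R}
    (hc : Ideal.Quotient.mk (I ^ n) c = AdicCompletion.evalₐ I n z)
    (hc' : Ideal.Quotient.mk (I ^ n') c' = AdicCompletion.evalₐ I n' z) : c' - c ∈ I ^ n := by
  obtain ⟨w, rfl⟩ := AdicCompletion.mk_surjective I R z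
  rw [AdicCompletion.evalₐ_mk] at hc hc'
  rw [← Ideal.Quotient.eq, hc, ← AdicCompletion.Ideal.mk_eq_mk I h w]
  rw [Ideal.Quotient.eq] at hc' ⊢
  exact Ideal.pow_le_pow_right h hc'

theorem matlis_act (htor : ∀ x : E, ∃ n : ℕ, ∀ a ∈ maximalIdeal R ^ n, a • x = 0)
    (z : AdicCompletion (maximalIdeal R) R) (x : E) :
    ∃ y : E, ∀ (n : ℕ) (c : R), (∀ a ∈ maximalIdeal R ^ n, a • x = 0) →
      Ideal.Quotient.mk (maximalIdeal R ^ n) c = AdicCompletion.evalₐ (maximalIdeal R) n z →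
      y = c • x := by
  obtain ⟨n₀, hn₀⟩ := htor x
  obtain ⟨c₀, hc₀⟩ := Ideal.Quotient.mk_surjective (AdicCompletion.evalₐ (maximalIdeal R) n₀ z)
  refine ⟨c₀ • x, fun n c hn hc => ?_⟩
  rcases le_total n₀ n with h | h
  · have := hn₀ _ (matlis_compat _ z h hc₀ hc)
    rw [sub_smul, sub_eq_zero] at this
    exact this.symm
  · have := hn _ (matlis_compat _ z h hc hc₀)
    rwa [sub_smul, sub_eq_zero] at this

end MatlisHelpers

/-- Matlis duality:  for a local noetherian ring `(R, m, k)` with `E = E_R(k)` the injective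
hull of the residue field, the homothety map `R̂ → Hom_R(E, E)` (i.e. the canonical `R`-algebra
homomorphism from the `m`-adic completion to the endomorphism ring of `E`, which exists and is
unique since `E` is `m`-torsion) is an isomorphism. -/
theorem matlis_homothety_bijective
    (R : Type u) [CommRing R] [IsLocalRing R] [IsNoetherianRing R]
    (E : Type u) [AddCommGroup E] [Module R E]
    (hE : IsInjectiveHullOfResidueField R E) :
    ∃ χ : AdicCompletion (IsLocalRing.maximalIdeal R) R →ₐ[R] Module.End R E,
      Function.Bijective χ := by
  obtain ⟨-, f, -, hf⟩ := id hE
  have htor := matlis_torsion f hf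
  choose act hact using matlis_act htor
  have hrep : ∀ (z : AdicCompletion (IsLocalRing.maximalIdeal R) R) (n : ℕ), ∃ c : R,
      Ideal.Quotient.mk (IsLocalRing.maximalIdeal R ^ n) c =
        AdicCompletion.evalₐ (IsLocalRing.maximalIdeal R) n z :=
    fun z n => Ideal.Quotient.mk_surjective _
  have hadd : ∀ z x y, act z (x + y) = act z x + act z y := by
    intro z x y
    obtain ⟨n, hn⟩ := htor x
    obtain ⟨k, hk⟩ := htor y
    have hn' : ∀ a ∈ IsLocalRing.maximalIdeal R ^ (n + k), a • x = 0 :=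
      fun a ha => hn a (Ideal.pow_le_pow_right (Nat.le_add_right n k) ha)
    have hk' : ∀ a ∈ IsLocalRing.maximalIdeal R ^ (n + k), a • y = 0 :=
      fun a ha => hk a (Ideal.pow_le_pow_right (Nat.le_add_left k n) ha)
    obtain ⟨c, hc⟩ := hrep z (n + k)
    rw [hact z x _ c hn' hc, hact z y _ c hk' hc, hact z (x + y) _ c
      (fun a ha => by rw [smul_add, hn' a ha, hk' a ha, add_zero]) hc, smul_add]
  have hsmul : ∀ z (b : R) x, act z (b • x) = b • act z x := by
    intro z b x
    obtain ⟨n, hn⟩ := htor x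
    obtain ⟨c, hc⟩ := hrep z n
    rw [hact z x _ c hn hc, hact z (b • x) _ c
      (fun a ha => by rw [smul_comm, hn a ha, smul_zero]) hc, smul_comm]
  let L : AdicCompletion (IsLocalRing.maximalIdeal R) R → Module.End R E := fun z =>
    { toFun := act z, map_add' := hadd z, map_smul' := hsmul z }
  have hL : ∀ z x, L z x = act z x := fun _ _ => rfl
  have halg : ∀ r : R, L (algebraMap R _ r) = algebraMap R (Module.End R E) r := by
    intro r
    ext x
    obtain ⟨n, hn⟩ := htor x
    rw [hL, Module.algebraMap_end_apply]
    exact hact _ x n r hn (by rw [AlgHom.commutes]; rfl)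
  let χ : AdicCompletion (IsLocalRing.maximalIdeal R) R →ₐ[R] Module.End R E :=
    { toFun := L
      map_one' := by
        have := halg 1
        rwa [map_one, map_one] at this
      map_zero' := by
        have := halg 0
        rwa [map_zero, map_zero] at this
      map_mul' := by
        intro z w
        ext x
        obtain ⟨n, hn⟩ := htor x
        obtain ⟨c, hc⟩ := hrep z n
        obtain ⟨d, hd⟩ := hrep w n
        rw [Module.End.mul_apply, hL, hL, hL, hact w x n d hn hd,
          hact z (d • x) n c (fun a ha => by rw [smul_comm, hn a ha, smul_zero]) hc,
          hact (z * w) x n (c * d) hn (by rw [map_mul, map_mul, hc, hd]), mul_smul]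
      map_add' := by
        intro z w
        ext x
        obtain ⟨n, hn⟩ := htor x
        obtain ⟨c, hc⟩ := hrep z n
        obtain ⟨d, hd⟩ := hrep w n
        rw [LinearMap.add_apply, hL, hL, hL, hact w x n d hn hd, hact z x n c hn hc,
          hact (z + w) x n (c + d) hn (by rw [map_add, map_add, hc, hd]), add_smul]
      commutes' := halg }
  have hχ : ∀ z x, χ z x = act z x := fun _ _ => rfl
  refine ⟨χ, ?_, ?_⟩
  · rw [injective_iff_map_eq_zero]
    intro z hz
    refine AdicCompletion.ext_evalₐ fun n => ?_
    obtain ⟨c, hc⟩ := hrep z n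
    rw [map_zero, ← hc, Ideal.Quotient.eq_zero_iff_mem]
    refine matlis_cogen hE _ c fun x hx => ?_
    rw [← hact z x n c hx hc, ← hχ, hz, LinearMap.zero_apply]
  · intro φ
    choose r hr using fun n => matlis_scalar f hf φ n _ (le_refl (IsLocalRing.maximalIdeal R ^ n))
    refine ⟨AdicCompletion.mk _ R (AdicCompletion.AdicCauchySequence.mk _ R r fun n => ?_), ?_⟩
    · rw [SModEq.sub_mem, smul_eq_mul, Ideal.mul_top]
      refine matlis_cogen hE _ _ fun x hx => ?_
      rw [sub_smul, ← hr n x hx, ← hr (n + 1) x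
        (fun a ha => hx a (Ideal.pow_le_pow_right (Nat.le_succ n) ha)), sub_self]
    · ext x
      obtain ⟨n, hn⟩ := htor x
      rw [hχ, hr n x hn]
      exact hact _ x n _ hn (by rw [AdicCompletion.evalₐ_mk]; rfl)

end
end

section
/- Let (R, m, k) be a local noetherian ring. An R-module T is quasi-dualizing (i.e., T is artinian, the homothety map R̂ → Hom_R(T,T) is an isomorphism, and Ext^i_R(T,T) = 0 for all i ≥ 1) if and only if T is m-adically semidualizing, meaning: T is m-torsion, Ext^i_R(R/m, T) is finitely generated (equivalently, finite-dimensional over k) for all i, the homothety map R̂ → Hom_R(T,T) is an isomorphism, and Ext^i_R(T,T) = 0 for all i ≥ 1. -/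
open CategoryTheory

noncomputable section
universe u

/-- `Ext^i_R(M, N)`. -/
abbrev extMod (R : Type u) [CommRing R] (i : ℕ) (M N : Type u) [AddCommGroup M] [Module R M]
    [AddCommGroup N] [Module R N] : ModuleCat R :=
  ((Ext R (ModuleCat.{u} R) i).obj (Opposite.op (ModuleCat.of R M))).obj (ModuleCat.of R N)

/-- `M` is `a`-torsion: every element is annihilated by a power of `a`. -/
def IsAdicTorsion (R : Type u) [CommRing R] (a : Ideal R) (M : Type u)
    [AddCommGroup M] [Module R M] : Prop :=
  ∀ x : M, ∃ n : ℕ, ∀ r ∈ a ^ n, r • x = 0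

/-- The homothety map `R̂ → Hom_R(M, M)` is an isomorphism:  there is a (necessarily unique)
`R`-algebra homomorphism from the `a`-adic completion to `End_R(M)` which is bijective. -/
def HomothetyIso (R : Type u) [CommRing R] (a : Ideal R) (M : Type u)
    [AddCommGroup M] [Module R M] : Prop :=
  ∃ χ : AdicCompletion a R →ₐ[R] Module.End R M, Function.Bijective χ

/-- `T` is quasi-dualizing over a local ring `R`:  `T` is artinian, the homothety map
`R̂ → Hom_R(T,T)` is an isomorphism, and `Ext^i_R(T,T) = 0` for `i ≥ 1`. -/
def IsQuasiDualizing (R : Type u) [CommRing R] [IsLocalRing R] (T : Type u)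
    [AddCommGroup T] [Module R T] : Prop :=
  IsArtinian R T ∧
  HomothetyIso R (IsLocalRing.maximalIdeal R) T ∧
  ∀ i : ℕ, 1 ≤ i → Subsingleton (extMod R i T T)

/-- `M` is `a`-adically semidualizing:  `M` is `a`-torsion, `Ext^i_R(R/a, M)` is finitely
generated for all `i`, the homothety map `R̂ → Hom_R(M,M)` is an isomorphism, and
`Ext^i_R(M,M) = 0` for `i ≥ 1`. -/
def IsAdicSemidualizing (R : Type u) [CommRing R] (a : Ideal R) (M : Type u)
    [AddCommGroup M] [Module R M] : Prop :=
  IsAdicTorsion R a M ∧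
  (∀ i : ℕ, Module.Finite R (extMod R i (R ⧸ a) M)) ∧
  HomothetyIso R a M ∧
  ∀ i : ℕ, 1 ≤ i → Subsingleton (extMod R i M M)

section helpers

open Limits

/-- Melkersson's argument for one element. -/
theorem isArtinian_of_torsionBy {R M : Type u} [CommRing R] [AddCommGroup M] [Module R M] (x : R)
    (htors : ∀ y : M, ∃ n : ℕ, x ^ n • y = 0)
    (hart : IsArtinian R (Submodule.torsionBy R M x)) : IsArtinian R M := by
  rw [← monotone_stabilizes_iff_artinian]
  intro N'
  let N : ℕ → Submodule R M := fun j => OrderDual.ofDual (N' j)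
  have hanti : ∀ {i j : ℕ}, i ≤ j → N j ≤ N i := fun h => N'.monotone h
  let K : ℕ → ℕ → Submodule R (Submodule.torsionBy R M x) := fun j n =>
    ((N j ⊓ Submodule.torsionBy R M (x ^ (n + 1))).map
      (LinearMap.lsmul R M (x ^ n))).comap (Submodule.torsionBy R M x).subtype
  have memK : ∀ j n z, z ∈ K j n ↔
      ∃ y ∈ N j, x ^ (n + 1) • y = 0 ∧ x ^ n • y = (z : M) := by
    intro j n z
    simp [K, and_assoc]
  have Kj : ∀ {i j : ℕ} (n : ℕ), i ≤ j → K j n ≤ K i n := by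
    intro i j n h z hz
    rw [memK] at hz ⊢
    obtain ⟨y, h1, h2⟩ := hz
    exact ⟨y, hanti h h1, h2⟩
  have Kn1 : ∀ (j n : ℕ), K j (n + 1) ≤ K j n := by
    intro j n z hz
    rw [memK] at hz ⊢
    obtain ⟨y, h1, h2, h3⟩ := hz
    refine ⟨x • y, (N j).smul_mem _ h1, ?_, ?_⟩
    · rw [smul_smul, ← pow_succ]; exact h2
    · rw [smul_smul, ← pow_succ]; exact h3
  have Kn : ∀ (j : ℕ) {n m : ℕ}, n ≤ m → K j m ≤ K j n := fun j n m h =>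
    antitone_nat_of_succ_le (Kn1 j) h
  -- stabilization of the diagonal
  have stab : ∀ f : ℕ → Submodule R (Submodule.torsionBy R M x), Antitone f →
      ∃ a, ∀ b, a ≤ b → f a = f b := fun f hf =>
    IsArtinian.monotone_stabilizes (R := R) ⟨f, fun i j h => hf h⟩
  obtain ⟨d, hd⟩ := stab (fun a => K a a) (fun a b h => (Kj b h).trans (Kn a h))
  have hs : ∀ n, ∃ a, ∀ b, a ≤ b → K a n = K b n := fun n =>
    stab (fun a => K a n) (fun a b h => Kj n h)
  choose s hs using hs
  let J := d + ∑ i ∈ Finset.range d, s i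
  have hJ : ∀ n j, J ≤ j → K J n ≤ K j n := by
    intro n j hj
    rcases lt_or_ge n d with hn | hn
    · have hsn : s n ≤ J := le_trans
        (Finset.single_le_sum (f := s) (fun _ _ => Nat.zero_le _) (Finset.mem_range.2 hn))
        (Nat.le_add_left _ _)
      rw [← hs n J hsn, ← hs n j (hsn.trans hj)]
    · have hdJ : d ≤ J := Nat.le_add_right _ _
      calc K J n ≤ K d d := (Kj n hdJ).trans (Kn d hn)
        _ = K (max j n) (max j n) := hd _ ((hdJ.trans hj).trans (le_max_left _ _))
        _ ≤ K j n := (Kj _ (le_max_left _ _)).trans (Kn j (le_max_right _ _))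
  refine ⟨J, fun j hj => ?_⟩
  have key : ∀ n : ℕ, ∀ y ∈ N J, x ^ n • y = 0 → y ∈ N j := by
    intro n
    induction n with
    | zero => intro y _ h; simp at h; simp [h]
    | succ n ih =>
      intro y hy h
      have hz : x ^ n • y ∈ Submodule.torsionBy R M x := by
        rw [Submodule.mem_torsionBy_iff, smul_smul, ← pow_succ']; exact h
      have h1 : (⟨x ^ n • y, hz⟩ : Submodule.torsionBy R M x) ∈ K J n :=
        (memK _ _ _).2 ⟨y, hy, h, rfl⟩
      obtain ⟨w, hw, _, hw2⟩ := (memK _ _ _).1 (hJ n j hj h1)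
      have := ih (y - w) ((N J).sub_mem hy (hanti hj hw)) (by rw [smul_sub, hw2, sub_self])
      simpa using (N j).add_mem this hw
  change N J = N j
  refine le_antisymm (fun y hy => ?_) (hanti hj)
  obtain ⟨n, hn⟩ := htors y
  exact key n y hy hn

theorem isArtinian_of_torsionBySet {R M : Type u} [CommRing R] [AddCommGroup M] [Module R M]
    (s : Finset R)
    (htors : ∀ x ∈ s, ∀ y : M, ∃ n : ℕ, x ^ n • y = 0)
    (hart : IsArtinian R (Submodule.torsionBySet R M (s : Set R))) : IsArtinian R M := by
  classical
  induction s using Finset.induction_on with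
  | empty =>
    have : Submodule.torsionBySet R M ((∅ : Finset R) : Set R) = ⊤ := by
      ext; simp [Submodule.mem_torsionBySet_iff]
    rw [this] at hart
    exact isArtinian_of_surjective _ (Submodule.topEquiv (R := R) (M := M)).toLinearMap
      Submodule.topEquiv.surjective
  | insert a s has ih =>
    refine ih (fun x hx => htors x (Finset.mem_insert_of_mem hx)) ?_
    refine isArtinian_of_torsionBy a (fun y => ?_) ?_
    · obtain ⟨n, hn⟩ := htors a (Finset.mem_insert_self a s) y
      exact ⟨n, Subtype.ext hn⟩
    · let S := Submodule.torsionBySet R M (s : Set R)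
      let f : Submodule.torsionBy R S a →ₗ[R] M := S.subtype ∘ₗ Submodule.subtype _
      let g : Submodule.torsionBy R S a →ₗ[R]
          Submodule.torsionBySet R M ((insert a s : Finset R) : Set R) :=
        f.codRestrict _ (fun z => by
          rw [Submodule.mem_torsionBySet_iff]
          rintro ⟨b, hb⟩
          rw [Finset.mem_coe, Finset.mem_insert] at hb
          rcases hb with rfl | hb
          · exact congrArg Subtype.val ((Submodule.mem_torsionBy_iff _ _).1 z.2)
          · exact (Submodule.mem_torsionBySet_iff _ _).1 z.1.2 ⟨b, hb⟩)
      refine isArtinian_of_injective g (fun z w h => ?_)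
      have h' : ((g z : Submodule.torsionBySet R M ((insert a s : Finset R) : Set R)) : M) = g w :=
        congrArg _ h
      exact Subtype.ext (Subtype.ext h')

theorem adicTorsion_of_isArtinian {R M : Type u} [CommRing R] [IsLocalRing R] [AddCommGroup M]
    [Module R M] [IsNoetherianRing R] [IsArtinian R M] (y : M) :
    ∃ n : ℕ, ∀ r ∈ IsLocalRing.maximalIdeal R ^ n, r • y = 0 := by
  let m := IsLocalRing.maximalIdeal R
  obtain ⟨n, hn⟩ := IsArtinian.monotone_stabilizes (R := R) (M := M)
    ⟨fun n => m ^ n • Submodule.span R {y}, fun i j h => by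
      exact Submodule.smul_mono_left (Ideal.pow_le_pow_right h)⟩
  have h1 : m ^ n • Submodule.span R {y} = m ^ (n + 1) • Submodule.span R {y} :=
    hn (n + 1) (Nat.le_succ n)
  have h2 : m ^ n • Submodule.span R {y} = ⊥ := by
    refine Submodule.eq_bot_of_le_smul_of_le_jacobson_bot m _ ?_ ?_ ?_
    · exact Submodule.FG.smul (IsNoetherian.noetherian (m ^ n)) (Submodule.fg_span_singleton y)
    · rw [← Submodule.mul_smul, ← pow_succ', ← h1]
    · exact IsLocalRing.maximalIdeal_le_jacobson _
  refine ⟨n, fun r hr => ?_⟩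
  have : r • y ∈ m ^ n • Submodule.span R {y} :=
    Submodule.smul_mem_smul hr (Submodule.mem_span_singleton_self y)
  rw [h2] at this
  simpa using this

/-- for modules killed by the maximal ideal, finite iff artinian -/
theorem finite_iff_isArtinian_of_killed {R M : Type u} [CommRing R] [IsLocalRing R]
    [AddCommGroup M] [Module R M]
    (h : ∀ r ∈ IsLocalRing.maximalIdeal R, ∀ y : M, r • y = 0) :
    Module.Finite R M ↔ IsArtinian R M := by
  let m := IsLocalRing.maximalIdeal R
  let _ : Field (R ⧸ m) := Ideal.Quotient.field m
  have hM : Module.IsTorsionBySet R M (m : Set R) := fun y r => h r.1 r.2 y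
  let _ : Module (R ⧸ m) M := hM.module
  have : IsScalarTower R (R ⧸ m) M := hM.isScalarTower
  have e1 : Module.Finite R M ↔ Module.Finite (R ⧸ m) M :=
    ⟨fun _ => Module.Finite.of_restrictScalars_finite R (R ⧸ m) M, fun _ =>
      Module.Finite.trans (R ⧸ m) M⟩
  have e2 : IsArtinian R M ↔ IsArtinian (R ⧸ m) M :=
    (LinearMap.isArtinian_iff_of_bijective (⟨⟨id, fun _ _ => rfl⟩, fun r y => by rfl⟩ : M →ₛₗ[Ideal.Quotient.mk m] M) Function.bijective_id)
  rw [e1, e2]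
  exact ((IsArtinianRing.tfae (R ⧸ m) M).out 0 2)

section
variable {R : Type u} [CommRing R]

/-- A finite free cover of a finite module -/
theorem exists_fcov (M : ModuleCat.{u} R) : ∃ (F : ModuleCat.{u} R) (p : F ⟶ M),
    Projective F ∧ Epi p ∧ (Module.Finite R M → Module.Finite R F) := by
  by_cases h : Module.Finite R M
  · obtain ⟨n, f, hf⟩ := Module.Finite.exists_fin' R M
    refine ⟨ModuleCat.of R (Fin n → R), ModuleCat.ofHom f, ?_, ?_, ?_⟩
    · exact (IsProjective.iff_projective (R := R) (Fin n → R)).1 inferInstance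
    · exact (ModuleCat.epi_iff_surjective _).2 hf
    · intro _; change Module.Finite R (Fin n → R); infer_instance
  · exact ⟨Projective.over M, Projective.π M, inferInstance, inferInstance, fun h' => (h h').elim⟩

def fcov (M : ModuleCat.{u} R) : ModuleCat.{u} R := (exists_fcov M).choose
def fcovπ (M : ModuleCat.{u} R) : fcov M ⟶ M := (exists_fcov M).choose_spec.choose
instance fcov_projective (M : ModuleCat.{u} R) : Projective (fcov M) :=
  (exists_fcov M).choose_spec.choose_spec.1
instance fcovπ_epi (M : ModuleCat.{u} R) : Epi (fcovπ M) :=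
  (exists_fcov M).choose_spec.choose_spec.2.1
theorem fcov_finite (M : ModuleCat.{u} R) (h : Module.Finite R M) : Module.Finite R (fcov M) :=
  (exists_fcov M).choose_spec.choose_spec.2.2 h

def fcovd {X Y : ModuleCat.{u} R} (f : X ⟶ Y) : fcov (kernel f) ⟶ X :=
  fcovπ (kernel f) ≫ kernel.ι f

@[simp]
theorem fcovd_comp {X Y : ModuleCat.{u} R} (f : X ⟶ Y) : fcovd f ≫ f = 0 := by
  simp [fcovd]

theorem fcovd_exact {X Y : ModuleCat.{u} R} (f : X ⟶ Y) :
    (ShortComplex.mk (fcovd f) f (fcovd_comp f)).Exact := by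
  let α : ShortComplex.mk (fcovd f) f (fcovd_comp f) ⟶
      ShortComplex.mk (kernel.ι f) f (kernel.condition f) :=
    { τ₁ := fcovπ _
      τ₂ := 𝟙 _
      τ₃ := 𝟙 _
      comm₁₂ := by simp [fcovd]
      comm₂₃ := by simp }
  have : Epi α.τ₁ := inferInstanceAs (Epi (fcovπ _))
  have : IsIso α.τ₂ := inferInstanceAs (IsIso (𝟙 _))
  have : Mono α.τ₃ := inferInstanceAs (Mono (𝟙 _))
  rw [ShortComplex.exact_iff_of_epi_of_isIso_of_mono α]
  apply ShortComplex.exact_of_f_is_kernel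
  apply kernelIsKernel

def fcomplex (Z : ModuleCat.{u} R) : ChainComplex (ModuleCat.{u} R) ℕ :=
  ChainComplex.mk' (fcov Z) (fcov (kernel (fcovπ Z)))
    (fcovd (fcovπ Z)) (fun f => ⟨fcov (kernel f), fcovd f, fcovd_comp f⟩)

theorem fcomplex_d_1_0 (Z : ModuleCat.{u} R) : (fcomplex Z).d 1 0 = fcovd (fcovπ Z) := by
  simp [fcomplex]

def fcomplexXIso (Z : ModuleCat.{u} R) (n : ℕ) :
    (fcomplex Z).X (n + 2) ≅ fcov (kernel ((fcomplex Z).d (n + 1) n)) :=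
  ChainComplex.mk'XIso _ _ _ _ n

theorem fcomplex_d (Z : ModuleCat.{u} R) (n : ℕ) :
    (fcomplex Z).d (n + 2) (n + 1) =
      (fcomplexXIso Z n).hom ≫ fcovd ((fcomplex Z).d (n + 1) n) :=
  ChainComplex.mk'_d _ _ _ _ n

theorem fcomplex_exactAt_succ (Z : ModuleCat.{u} R) (n : ℕ) : (fcomplex Z).ExactAt (n + 1) := by
  rw [HomologicalComplex.exactAt_iff' _ (n + 1 + 1) (n + 1) n (by simp) (by simp)]
  let e : (fcomplex Z).sc' (n + 1 + 1) (n + 1) n ≅ ShortComplex.mk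
      (fcovd ((fcomplex Z).d (n + 1) n)) ((fcomplex Z).d (n + 1) n) (fcovd_comp _) :=
    ShortComplex.isoMk (fcomplexXIso Z n) (Iso.refl _) (Iso.refl _)
      ((fcomplex_d Z n).symm.trans (Category.comp_id _).symm)
      ((Category.id_comp _).trans (Category.comp_id _).symm)
  exact (ShortComplex.exact_iff_of_iso e).2 (fcovd_exact ((fcomplex Z).d (n + 1) n))

instance fcomplex_projective (Z : ModuleCat.{u} R) (n : ℕ) : Projective ((fcomplex Z).X n) := by
  obtain (_ | _ | n) := n
  · exact fcov_projective _
  · exact fcov_projective _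
  · exact Projective.of_iso (fcomplexXIso Z n).symm (fcov_projective _)

theorem kernel_finite [IsNoetherianRing R] {X Y : ModuleCat.{u} R} (f : X ⟶ Y)
    (h : Module.Finite R X) : Module.Finite R (kernel f : ModuleCat.{u} R) :=
  Module.Finite.of_injective (kernel.ι f).hom ((ModuleCat.mono_iff_injective _).1 inferInstance)

theorem fcomplex_finite [IsNoetherianRing R] (Z : ModuleCat.{u} R) (hZ : Module.Finite R Z)
    (n : ℕ) : Module.Finite R ((fcomplex Z).X n) := by
  have h0 : Module.Finite R ((fcomplex Z).X 0) := fcov_finite _ hZ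
  have h1 : Module.Finite R ((fcomplex Z).X 1) :=
    fcov_finite _ (kernel_finite _ (fcov_finite _ hZ))
  suffices H : Module.Finite R ((fcomplex Z).X n) ∧ Module.Finite R ((fcomplex Z).X (n + 1)) from H.1
  induction n with
  | zero => exact ⟨h0, h1⟩
  | succ n ih =>
    refine ⟨ih.2, ?_⟩
    have := fcov_finite _ (kernel_finite ((fcomplex Z).d (n + 1) n) ih.2)
    exact Module.Finite.equiv (fcomplexXIso Z n).symm.toLinearEquiv

def fres (Z : ModuleCat.{u} R) : ProjectiveResolution Z where
  complex := fcomplex Z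
  π := (ChainComplex.toSingle₀Equiv _ _).symm ⟨fcovπ Z, by
          rw [fcomplex_d_1_0]; exact fcovd_comp _⟩
  quasiIso := ⟨fun n => by
    cases n
    · rw [ChainComplex.quasiIsoAt₀_iff, ShortComplex.quasiIso_iff_of_zeros']
      · refine (ShortComplex.exact_and_epi_g_iff_of_iso (ShortComplex.isoMk (Iso.refl _) (Iso.refl _) (Iso.refl _) ?_ ?_)).2
          ⟨fcovd_exact (fcovπ Z), fcovπ_epi Z⟩
        · exact (Category.id_comp _).trans ((fcomplex_d_1_0 Z).symm.trans (Category.comp_id _).symm)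
        · refine (Category.id_comp _).trans (Eq.trans ?_ (Category.comp_id _).symm)
          simp
          rfl
      all_goals rfl
    · rw [quasiIsoAt_iff_exactAt']
      · apply fcomplex_exactAt_succ
      · apply ChainComplex.exactAt_succ_single_obj⟩

theorem homology_killed {X : ModuleCat.{u} R} (P : ProjectiveResolution X) (Y : ModuleCat.{u} R)
    (r : R) (hr : ∀ x : X, r • x = 0) (n : ℕ)
    (y : ((P.complex.linearYonedaObj R Y).homology n : ModuleCat R)) : r • y = 0 := by
  have hc : (r • 𝟙 P.complex) ≫ P.π = 0 := by
    refine HomologicalComplex.to_single_hom_ext ?_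
    rw [HomologicalComplex.comp_f, HomologicalComplex.smul_f_apply, HomologicalComplex.id_f,
      Linear.smul_comp, Category.id_comp, HomologicalComplex.zero_f]
    ext p
    exact hr ((P.π.f 0).hom p)
  let h : Homotopy (r • 𝟙 P.complex) 0 := ProjectiveResolution.liftHomotopyZero _ hc
  let K := P.complex.linearYonedaObj R Y
  obtain ⟨z, rfl⟩ := (ModuleCat.epi_iff_surjective (K.homologyπ n)).1 inferInstance y
  let f : P.complex.X n ⟶ Y := K.iCycles n z
  have hf : P.complex.d (n + 1) n ≫ f = 0 := by
    have := congrArg (fun t => t.hom z) (K.iCycles_d n (n + 1))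
    exact this
  have hrf : r • f = dNext n h.hom ≫ f := by
    have h1 := h.comm n
    have h2 := congrArg (fun t => t ≫ f) h1
    have h3 : ((r • 𝟙 P.complex : P.complex ⟶ P.complex).f n) ≫ f = r • f := by
      rw [HomologicalComplex.smul_f_apply]; simp
    rw [Homotopy.prevD_chainComplex] at h2
    simp only [HomologicalComplex.zero_f, add_zero, Preadditive.add_comp, Category.assoc, hf,
      comp_zero] at h2
    exact h3.symm.trans h2
  have hinj : Function.Injective (K.iCycles n) :=
    (ModuleCat.mono_iff_injective (K.iCycles n)).1 inferInstance
  rw [← map_smul]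
  rcases n with _ | n
  · rw [Homotopy.dNext_zero_chainComplex, zero_comp] at hrf
    have : r • z = 0 := hinj (by rw [map_smul, map_zero]; exact hrf)
    rw [this, map_zero]
  · rw [Homotopy.dNext_succ_chainComplex, Category.assoc] at hrf
    let w : K.X n := (h.hom n (n + 1) ≫ f : P.complex.X n ⟶ Y)
    have : r • z = K.toCycles n (n + 1) w := hinj (by
      rw [map_smul]
      have := congrArg (fun t => t.hom w) (K.toCycles_i n (n + 1))
      exact hrf.trans this.symm)
    rw [this]
    exact congrArg (fun t => t.hom w) (K.toCycles_comp_homologyπ n (n + 1))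

theorem isArtinian_hom {M N : Type u} [AddCommGroup M] [Module R M] [AddCommGroup N] [Module R N]
    [Module.Finite R M] [IsArtinian R N] : IsArtinian R (M →ₗ[R] N) := by
  obtain ⟨n, f, hf⟩ := Module.Finite.exists_fin' R M
  let g : (M →ₗ[R] N) →ₗ[R] (Fin n → N) :=
    LinearMap.pi (fun i => LinearMap.applyₗ (f (Pi.single i 1)))
  refine isArtinian_of_injective g ((injective_iff_map_eq_zero g).2 fun a ha => ?_)
  have : a ∘ₗ f = 0 := by
    refine LinearMap.pi_ext' fun i => LinearMap.ext_ring ?_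
    exact congrFun ha i
  ext x
  obtain ⟨y, rfl⟩ := hf x
  exact LinearMap.congr_fun this y

theorem homology_isArtinian {X : ModuleCat.{u} R} (P : ProjectiveResolution X)
    (Y : ModuleCat.{u} R) [IsArtinian R Y] (n : ℕ) [Module.Finite R (P.complex.X n)] :
    IsArtinian R ((P.complex.linearYonedaObj R Y).homology n : ModuleCat R) := by
  let K := P.complex.linearYonedaObj R Y
  have h0 : IsArtinian R (P.complex.X n →ₗ[R] Y) := isArtinian_hom
  have h1 : IsArtinian R (K.X n) :=
    isArtinian_of_surjective _ (ModuleCat.homLinearEquiv (S := R)).symm.toLinearMap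
      (ModuleCat.homLinearEquiv (S := R) (M := P.complex.X n) (N := Y)).symm.surjective
  have h2 : IsArtinian R (K.cycles n) := isArtinian_of_injective (K.iCycles n).hom
    ((ModuleCat.mono_iff_injective (K.iCycles n)).1 inferInstance)
  exact isArtinian_of_surjective _ (K.homologyπ n).hom
    ((ModuleCat.epi_iff_surjective (K.homologyπ n)).1 inferInstance)

theorem socle_finite [IsNoetherianRing R] (I : Ideal R) (Y : ModuleCat.{u} R)
    (P : ProjectiveResolution (ModuleCat.of R (R ⧸ I)))
    (hfin : Module.Finite R ((P.complex.linearYonedaObj R Y).homology 0 : ModuleCat R)) :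
    Module.Finite R (Submodule.torsionBySet R Y (I : Set R)) := by
  let K := P.complex.linearYonedaObj R Y
  have h1 : Module.Finite R (K.cycles 0) :=
    Module.Finite.equiv (CochainComplex.isoHomologyπ₀ K).symm.toLinearEquiv
  let S := Submodule.torsionBySet R Y (I : Set R)
  have hle : ∀ t : S, I ≤ LinearMap.ker (LinearMap.toSpanSingleton R Y t) := fun t r hr =>
    (Submodule.mem_torsionBySet_iff _ _).1 t.2 ⟨r, hr⟩
  let φ : S →ₗ[R] (R ⧸ I →ₗ[R] Y) :=
    { toFun := fun t => Submodule.liftQ I (LinearMap.toSpanSingleton R Y t) (hle t)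
      map_add' := fun a b => by
        refine Submodule.linearMap_qext _ (LinearMap.ext_ring ?_)
        change (1 : R) • ((a : Y) + b) = (1 : R) • (a : Y) + (1 : R) • (b : Y)
        rw [smul_add]
      map_smul' := fun a b => by
        refine Submodule.linearMap_qext _ (LinearMap.ext_ring ?_)
        change (1 : R) • (a • (b : Y)) = a • (1 : R) • (b : Y)
        rw [one_smul, one_smul] }
  let p : P.complex.X 0 ⟶ ModuleCat.of R (R ⧸ I) := P.π.f 0
  have hp : P.complex.d 1 0 ≫ p = 0 := P.complex_d_comp_π_f_zero
  have hpe : Epi p := inferInstanceAs (Epi (P.π.f 0))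
  let k : ModuleCat.of R S ⟶ K.X 0 := ModuleCat.ofHom
    { toFun := fun t => (p ≫ ModuleCat.ofHom (φ t) : P.complex.X 0 ⟶ Y)
      map_add' := fun a b => by
        rw [map_add]; exact Preadditive.comp_add _ _ _ _ (ModuleCat.ofHom (φ a)) (ModuleCat.ofHom (φ b))
      map_smul' := fun a b => by
        rw [map_smul]; exact Linear.comp_smul _ _ _ _ a (ModuleCat.ofHom (φ b)) }
  have hk : k ≫ K.d 0 1 = 0 := by
    ext t
    change P.complex.d 1 0 ≫ p ≫ ModuleCat.ofHom (φ t) = 0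
    rw [← Category.assoc, hp, zero_comp]
  have hkinj : Function.Injective k := by
    intro a b hab
    have hab' : p ≫ ModuleCat.ofHom (φ a) = p ≫ ModuleCat.ofHom (φ b) := hab
    have h2 := congrArg ModuleCat.Hom.hom ((cancel_epi p).1 hab')
    have h3 := LinearMap.congr_fun h2 (Submodule.Quotient.mk 1)
    refine Subtype.ext ?_
    have h4 : (1 : R) • (a : Y) = (1 : R) • (b : Y) := h3
    rwa [one_smul, one_smul] at h4
  let l := K.liftCycles k 1 (by simp) hk
  have hl : l ≫ K.iCycles 0 = k := K.liftCycles_i _ _ _ _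
  refine Module.Finite.of_injective l.hom (fun a b hab => hkinj ?_)
  rw [← hl]
  exact congrArg (K.iCycles 0) hab

end

theorem extMod_isoHomology_finite_iff (R : Type u) [CommRing R] (T : Type u) [AddCommGroup T]
    [Module R T] (I : Ideal R) (i : ℕ) :
    Module.Finite R (extMod R i (R ⧸ I) T) ↔
    Module.Finite R (((fres (ModuleCat.of R (R ⧸ I))).complex.linearYonedaObj R
      (ModuleCat.of R T)).homology i : ModuleCat R) := by
  let e := ((fres (ModuleCat.of R (R ⧸ I))).isoExt (R := R) i (ModuleCat.of R T)).toLinearEquiv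
  exact ⟨fun _ => Module.Finite.equiv e, fun _ => Module.Finite.equiv e.symm⟩

theorem isArtinian_iff_adic (R : Type u) [CommRing R] [IsLocalRing R] [IsNoetherianRing R]
    (T : Type u) [AddCommGroup T] [Module R T] :
    IsArtinian R T ↔ IsAdicTorsion R (IsLocalRing.maximalIdeal R) T ∧
      ∀ i : ℕ, Module.Finite R (extMod R i (R ⧸ IsLocalRing.maximalIdeal R) T) := by
  let m := IsLocalRing.maximalIdeal R
  constructor
  · intro hT
    refine ⟨fun y => adicTorsion_of_isArtinian y, fun i => ?_⟩
    rw [extMod_isoHomology_finite_iff]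
    rw [finite_iff_isArtinian_of_killed]
    · have hZ : Module.Finite R (ModuleCat.of R (R ⧸ m)) :=
        inferInstanceAs (Module.Finite R (R ⧸ m))
      have hfin : Module.Finite R ((fres (ModuleCat.of R (R ⧸ m))).complex.X i) :=
        fcomplex_finite _ hZ i
      have hT' : IsArtinian R (ModuleCat.of R T) := hT
      exact homology_isArtinian _ _ i
    · intro r hr y
      refine homology_killed _ _ r ?_ i y
      intro x
      obtain ⟨x, rfl⟩ := Ideal.Quotient.mk_surjective x
      exact Ideal.Quotient.eq_zero_iff_mem.2 (m.mul_mem_right x hr)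
  · rintro ⟨htors, hfin⟩
    have h0 := (extMod_isoHomology_finite_iff R T m 0).1 (hfin 0)
    have h1 : Module.Finite R (Submodule.torsionBySet R T (m : Set R)) :=
      socle_finite m (ModuleCat.of R T) _ h0
    rw [finite_iff_isArtinian_of_killed (fun r hr y => Subtype.ext
      ((Submodule.mem_torsionBySet_iff _ _).1 y.2 ⟨r, hr⟩))] at h1
    obtain ⟨s, hs⟩ := (IsNoetherian.noetherian m : m.FG)
    refine isArtinian_of_torsionBySet s (fun x hx y => ?_) ?_
    · obtain ⟨n, hn⟩ := htors y
      refine ⟨n, hn _ (Ideal.pow_mem_pow ?_ n)⟩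
      change x ∈ m
      rw [← hs]
      exact Submodule.subset_span hx
    · have h2 : Submodule.torsionBySet R T (s : Set R) =
          Submodule.torsionBySet R T (m : Set R) := by
        rw [← hs]
        exact Submodule.torsionBySet_eq_torsionBySet_span (s : Set R)
      rw [h2]
      exact h1

end helpers

/-- For a local noetherian ring `(R, m, k)`, an `R`-module `T` is quasi-dualizing if and only
if it is `m`-adically semidualizing. -/
theorem isQuasiDualizing_iff_isAdicSemidualizing
    (R : Type u) [CommRing R] [IsLocalRing R] [IsNoetherianRing R]
    (T : Type u) [AddCommGroup T] [Module R T] :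
    IsQuasiDualizing R T ↔ IsAdicSemidualizing R (IsLocalRing.maximalIdeal R) T := by
  unfold IsQuasiDualizing IsAdicSemidualizing
  rw [isArtinian_iff_adic, and_assoc]

end
end

section
/- Let R be a commutative noetherian ring and a a proper ideal generated by elements y₁,…,yₙ. For a bounded complex (or module) X over R, the following are equivalent: (1) H_i(K(y) ⊗_R X) is finitely generated for all i, where K(y) is the Koszul complex on y₁,…,yₙ; (2) Tor^R_i(R/a, X) is finitely generated for all i; (3) Ext^i_R(R/a, X) is finitely generated for all i. -/
open CategoryTheory

noncomputable section
universe u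

/-- The Koszul complex on a list of elements `y₁, …, yₙ` of `R` tensored with a module `X`,
built recursively as an iterated mapping cone of multiplication maps:
`K(∅) ⊗ X = X` and `K(y :: ys) ⊗ X = cone(y · : K(ys) ⊗ X → K(ys) ⊗ X)`. -/
def koszulTensor (R : Type u) [CommRing R] (X : ModuleCat.{u} R) :
    List R → CochainComplex (ModuleCat.{u} R) ℤ
  | [] => (HomologicalComplex.single (ModuleCat.{u} R) (ComplexShape.up ℤ) 0).obj X
  | y :: ys => CochainComplex.mappingCone (y • 𝟙 (koszulTensor R X ys))

/-- Abstract finiteness data. -/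
structure KData (R : Type u) [CommRing R]
    (h : List R → ℤ → (M : Type u) → [AddCommGroup M] → [Module R M] → Prop) : Prop where
  iso : ∀ (ys : List R) (i : ℤ) (A B : Type u) [AddCommGroup A] [Module R A]
    [AddCommGroup B] [Module R B], (A ≃ₗ[R] B) → h ys i A → h ys i B
  zero : ∀ (ys : List R) (i : ℤ) (A : Type u) [AddCommGroup A] [Module R A],
    Subsingleton A → h ys i A
  mid : ∀ (ys : List R) (i : ℤ) (A B C : Type u) [AddCommGroup A] [Module R A]
    [AddCommGroup B] [Module R B] [AddCommGroup C] [Module R C]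
    (f : A →ₗ[R] B) (g : B →ₗ[R] C), Function.Injective f → Function.Surjective g →
    Function.Exact f g → h ys i A → h ys i C → h ys i B
  right : ∀ (ys : List R) (i : ℤ) (A B C : Type u) [AddCommGroup A] [Module R A]
    [AddCommGroup B] [Module R B] [AddCommGroup C] [Module R C]
    (f : A →ₗ[R] B) (g : B →ₗ[R] C), Function.Injective f → Function.Surjective g →
    Function.Exact f g → h ys i B → h ys (i + 1) A → h ys i C
  up : ∀ (y : R) (ys : List R) (A : Type u) [AddCommGroup A] [Module R A],
    (∀ i, h ys i A) → ∀ i, h (y :: ys) i A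
  down : ∀ (y : R) (ys : List R) (A : Type u) [AddCommGroup A] [Module R A],
    (∀ x : A, y • x = 0) → (∀ i, h (y :: ys) i A) → ∀ i, h ys i A
  reg : ∀ (y : R) (ys : List R) (A C : Type u) [AddCommGroup A] [Module R A]
    [AddCommGroup C] [Module R C] (g : A →ₗ[R] C),
    Function.Injective (y • LinearMap.id : A →ₗ[R] A) → Function.Surjective g →
    Function.Exact (y • LinearMap.id : A →ₗ[R] A) g → (∀ i, h ys i C) → ∀ i, h (y :: ys) i A
  bdd : ∀ ys : List R, ∃ N : ℤ, ∀ (A : Type u) [AddCommGroup A] [Module R A],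
    ∀ i, N < i → h ys i A

namespace KData

variable {R : Type u} [CommRing R] [IsNoetherianRing R]
  {h : List R → ℤ → (M : Type u) → [AddCommGroup M] → [Module R M] → Prop}

theorem dimShift (H : KData R h) (ys : List R) (b : Ideal R) (hb : ∀ i, h ys i (R ⧸ b)) :
    ∀ (i : ℤ) (M : Type u) [AddCommGroup M] [Module R M] [Module.Finite R M],
      (∀ r ∈ b, ∀ x : M, r • x = 0) → h ys i M := by
  obtain ⟨N, hN⟩ := H.bdd ys
  have key : ∀ (n : ℕ) (i : ℤ), N + 1 - n ≤ i → ∀ (M : Type u) [AddCommGroup M] [Module R M]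
      [Module.Finite R M], (∀ r ∈ b, ∀ x : M, r • x = 0) → h ys i M := by
    intro n
    induction n with
    | zero => intro i hi M _ _ _ _; exact hN M i (by simp at hi; omega)
    | succ n ih =>
      intro i hi M _ _ hM
      refine IsNoetherianRing.induction_on_isQuotientEquivQuotientPrime R hM
        (motive := fun N _ _ _ => (∀ r ∈ b, ∀ x : N, r • x = 0) → h ys i N) ?_ ?_ ?_
      · intro N _ _ _ hs _
        exact H.zero ys i N hs
      · intro N _ _ _ p e hk
        have hbp : b ≤ p.1 := by
          intro r hr
          have := hk r hr (e.symm 1)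
          rw [← map_smul, LinearEquiv.map_eq_zero_iff, Algebra.smul_def, mul_one] at this
          exact Ideal.Quotient.eq_zero_iff_mem.mp this
        refine H.iso ys i _ _ e.symm ?_
        let g : (R ⧸ b) →ₗ[R] (R ⧸ p.1) := (Ideal.Quotient.factorₐ R hbp).toLinearMap
        refine H.right ys i (LinearMap.ker g) (R ⧸ b) (R ⧸ p.1) (LinearMap.ker g).subtype g
          (Submodule.subtype_injective _) (Ideal.Quotient.factor_surjective hbp)
          (LinearMap.exact_subtype_ker_map g) (hb i) (ih (i + 1) (by push_cast at hi; omega) _ ?_)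
        rintro r hr ⟨x, hx⟩
        obtain ⟨x, rfl⟩ := Ideal.Quotient.mk_surjective x
        ext
        change r • (Ideal.Quotient.mk b x) = 0
        rw [Algebra.smul_def]
        change Ideal.Quotient.mk b r * _ = 0
        rw [Ideal.Quotient.eq_zero_iff_mem.mpr hr, zero_mul]
      · intro N₁ _ _ _ N₂ _ _ _ N₃ _ _ _ f g hf hg hfg h1 h3 hk
        refine H.mid ys i N₁ N₂ N₃ f g hf hg hfg (h1 ?_) (h3 ?_)
        · intro r hr x
          apply hf
          rw [map_smul, hk r hr, map_zero]
        · intro r hr x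
          obtain ⟨x, rfl⟩ := hg x
          rw [← map_smul, hk r hr, map_zero]
  intro i M _ _ _ hk
  exact key (N + 1 - i).toNat i (by have := Int.self_le_toNat (N + 1 - i); omega) M hk

theorem climb (H : KData R h) (a : Ideal R) (ha : ∀ (i : ℤ) (M : Type u) [AddCommGroup M]
      [Module R M] [Module.Finite R M], (∀ r ∈ a, ∀ x : M, r • x = 0) → h [] i M)
    (ys : List R) : ∀ (J : Ideal R), a ≤ J ⊔ Ideal.span {r | r ∈ ys} →
      ∀ (M : Type u) [AddCommGroup M] [Module R M] [Module.Finite R M],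
      (∀ r ∈ J, ∀ x : M, r • x = 0) → ∀ i, h ys i M := by
  induction ys with
  | nil =>
    intro J hJ M _ _ _ hk i
    refine ha i M fun r hr => hk r ?_
    simpa using hJ hr
  | cons y ys ih =>
    intro J hJ M _ _ hM hk
    have hJ' : a ≤ (J ⊔ Ideal.span {y}) ⊔ Ideal.span {r | r ∈ ys} := by
      refine hJ.trans (le_of_eq ?_)
      rw [sup_assoc, ← Ideal.span_union]
      congr 2
      ext; simp
    have ih' : ∀ (M : Type u) [AddCommGroup M] [Module R M] [Module.Finite R M],
      (∀ r ∈ J, ∀ x : M, r • x = 0) → (∀ x : M, y • x = 0) → ∀ i, h ys i M := by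
      intro M _ _ _ h1 h2
      refine ih _ hJ' M ?_
      intro r hr x
      obtain ⟨s, hs, t, ht, rfl⟩ := Submodule.mem_sup.mp hr
      obtain ⟨c, rfl⟩ := Ideal.mem_span_singleton'.mp ht
      rw [add_smul, h1 s hs, mul_smul, h2, smul_zero, add_zero]
    revert hk
    refine IsNoetherianRing.induction_on_isQuotientEquivQuotientPrime R hM
        (motive := fun N _ _ _ => (∀ r ∈ J, ∀ x : N, r • x = 0) → ∀ i, h (y :: ys) i N) ?_ ?_ ?_
    · intro N _ _ _ hs _ i
      exact H.zero _ i N hs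
    · intro N _ _ _ p e hk
      by_cases hy : y ∈ p.1
      · refine H.up y ys N (ih' N hk ?_)
        intro x
        apply e.injective
        rw [map_smul, map_zero]
        obtain ⟨z, hz⟩ := Ideal.Quotient.mk_surjective (e x)
        rw [← hz, Algebra.smul_def]
        change Ideal.Quotient.mk p.1 y * _ = 0
        rw [Ideal.Quotient.eq_zero_iff_mem.mpr hy, zero_mul]
      · refine H.reg y ys N (N ⧸ LinearMap.range (y • LinearMap.id : N →ₗ[R] N))
          (Submodule.mkQ _) ?_ (Submodule.mkQ_surjective _) (LinearMap.exact_map_mkQ_range _)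
          (ih' _ ?_ ?_)
        · rw [injective_iff_map_eq_zero]
          intro x hx
          apply e.injective
          rw [map_zero]
          replace hx : y • e x = 0 := by
            rw [← map_smul]; change e ((y • LinearMap.id : N →ₗ[R] N) x) = 0; rw [hx, map_zero]
          obtain ⟨z, hz⟩ := Ideal.Quotient.mk_surjective (e x)
          rw [← hz, Algebra.smul_def] at hx
          change Ideal.Quotient.mk p.1 y * _ = 0 at hx
          rw [← map_mul, Ideal.Quotient.eq_zero_iff_mem] at hx
          rw [← hz, Ideal.Quotient.eq_zero_iff_mem]
          exact (p.2.mem_or_mem hx).resolve_left hy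
        · intro r hr x
          obtain ⟨x, rfl⟩ := Submodule.mkQ_surjective _ x
          rw [← map_smul, hk r hr, map_zero]
        · intro x
          obtain ⟨x, rfl⟩ := Submodule.mkQ_surjective _ x
          rw [← map_smul, Submodule.mkQ_apply, Submodule.Quotient.mk_eq_zero]
          exact ⟨x, rfl⟩
    · intro N₁ _ _ _ N₂ _ _ _ N₃ _ _ _ f g hf hg hfg h1 h3 hk i
      refine H.mid _ i N₁ N₂ N₃ f g hf hg hfg (h1 ?_ i) (h3 ?_ i)
      · intro r hr x
        apply hf
        rw [map_smul, hk r hr, map_zero]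
      · intro r hr x
        obtain ⟨x, rfl⟩ := hg x
        rw [← map_smul, hk r hr, map_zero]

theorem descend (H : KData R h) (M : Type u) [AddCommGroup M] [Module R M] (ys : List R) :
    (∀ r ∈ ys, ∀ x : M, r • x = 0) → (∀ i, h ys i M) → ∀ i, h [] i M := by
  induction ys with
  | nil => exact fun _ h => h
  | cons y ys ih =>
    intro hk hi
    exact ih (fun r hr => hk r (by simp [hr])) (H.down y ys M (hk y (by simp)) hi)

theorem equiv (H : KData R h) (a : Ideal R) (ys : List R) (hy : Ideal.span {r : R | r ∈ ys} = a) :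
    (∀ i, h ys i R) ↔ ∀ i, h [] i (R ⧸ a) := by
  have hka : ∀ r ∈ a, ∀ x : R ⧸ a, r • x = 0 := by
    intro r hr x
    rw [Algebra.smul_def]
    change Ideal.Quotient.mk a r * _ = 0
    rw [Ideal.Quotient.eq_zero_iff_mem.mpr hr, zero_mul]
  constructor
  · intro h1
    refine H.descend (R ⧸ a) ys (fun r hr => hka r (hy ▸ Ideal.subset_span hr)) fun i => ?_
    refine H.dimShift ys ⊥ (fun i => ?_) i (R ⧸ a) ?_
    · exact H.iso ys i R _ (Submodule.quotEquivOfEqBot ⊥ rfl).symm (h1 i)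
    · intro r hr x
      rw [Ideal.mem_bot.mp hr, zero_smul]
  · intro h1
    exact H.climb a (H.dimShift [] a h1) ys ⊥ (by rw [hy]; simp) R (by
      intro r hr x
      rw [Ideal.mem_bot.mp hr, zero_smul])

end KData

section Cone

open CochainComplex HomologicalComplex

/-- Cochain complexes of modules. -/
abbrev CCx (R : Type u) [CommRing R] := CochainComplex (ModuleCat.{u} R) ℤ

variable {R : Type u} [CommRing R]

/-- The cone of multiplication by `y`, as a functor. -/
def coneF (y : R) : CCx R ⥤ CCx R where
  obj C := mappingCone (y • 𝟙 C)
  map {C D} f := mappingCone.map (y • 𝟙 C) (y • 𝟙 D) f f (by simp)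
  map_id C := mappingCone.map_id _
  map_comp f g := mappingCone.map_comp _ _ _ _ _ _ _ _ _

/-- The iterated cone functor. -/
def kz : List R → (CCx R ⥤ CCx R)
  | [] => 𝟭 _
  | y :: ys => kz ys ⋙ coneF y

theorem koszulTensor_eq (X : ModuleCat.{u} R) (ys : List R) :
    koszulTensor R X ys =
      (kz ys).obj ((HomologicalComplex.single (ModuleCat.{u} R) (ComplexShape.up ℤ) 0).obj X) := by
  induction ys with
  | nil => rfl
  | cons y ys ih =>
    change mappingCone (y • 𝟙 (koszulTensor R X ys)) = mappingCone (y • 𝟙 _)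
    rw [ih]

/-- The map of cones induced by a map. -/
abbrev coneMap (y : R) {C D : CCx R} (f : C ⟶ D) : mappingCone (y • 𝟙 C) ⟶ mappingCone (y • 𝟙 D) :=
  mappingCone.map (y • 𝟙 C) (y • 𝟙 D) f f (by simp)

theorem coneMap_smul (y r : R) {C D : CCx R} (f : C ⟶ D) :
    coneMap y (r • f) = r • coneMap y f := by
  ext1 n
  rw [HomologicalComplex.smul_f_apply, mappingCone.ext_from_iff _ (n + 1) n rfl]
  simp [mappingCone.map]

theorem coneF_smul (y r : R) {C D : CCx R} (f : C ⟶ D) :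
    (coneF y).map (r • f) = r • (coneF y).map f := coneMap_smul y r f

theorem kz_smul (ys : List R) (r : R) {C D : CCx R} (f : C ⟶ D) :
    (kz ys).map (r • f) = r • (kz ys).map f := by
  induction ys with
  | nil => rfl
  | cons y ys ih =>
    change (coneF y).map ((kz ys).map (r • f)) = r • (coneF y).map ((kz ys).map f)
    rw [ih, coneF_smul]

instance coneF_zero (y : R) : (coneF y).PreservesZeroMorphisms where
  map_zero C D := by
    rw [← zero_smul R (0 : C ⟶ D), coneF_smul, zero_smul]

instance kz_zero (ys : List R) : (kz ys).PreservesZeroMorphisms where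
  map_zero C D := by
    rw [← zero_smul R (0 : C ⟶ D), kz_smul, zero_smul]

theorem coneMap_fst (y : R) {C D : CCx R} (f : C ⟶ D) (n : ℤ) :
    (coneMap y f).f n ≫ (mappingCone.fst (y • 𝟙 D)).1.v n (n + 1) rfl =
      (mappingCone.fst (y • 𝟙 C)).1.v n (n + 1) rfl ≫ f.f (n + 1) := by
  rw [mappingCone.ext_from_iff _ (n + 1) n rfl]
  simp [mappingCone.map]

theorem coneMap_snd (y : R) {C D : CCx R} (f : C ⟶ D) (n : ℤ) :
    (coneMap y f).f n ≫ (mappingCone.snd (y • 𝟙 D)).v n n (add_zero n) =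
      (mappingCone.snd (y • 𝟙 C)).v n n (add_zero n) ≫ f.f n := by
  rw [mappingCone.ext_from_iff _ (n + 1) n rfl]
  simp [mappingCone.map]

theorem cone_bij (y : R) (C : CCx R) (n : ℤ) : Function.Bijective
    (fun x : (mappingCone (y • 𝟙 C)).X n =>
      (((mappingCone.fst (y • 𝟙 C)).1.v n (n + 1) rfl).hom x,
        ((mappingCone.snd (y • 𝟙 C)).v n n (add_zero n)).hom x)) := by
  have e1 := mappingCone.id_X (y • 𝟙 C) n (n + 1) rfl
  have a1 := mappingCone.inl_v_fst_v (y • 𝟙 C) (n + 1) n rfl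
  have a2 := mappingCone.inl_v_snd_v (y • 𝟙 C) (n + 1) n (by simp)
  have a3 := mappingCone.inr_f_fst_v (y • 𝟙 C) n (n + 1) rfl
  have a4 := mappingCone.inr_f_snd_v (y • 𝟙 C) n
  constructor
  · intro x z h
    simp only [Prod.mk.injEq] at h
    have hx := ConcreteCategory.congr_hom e1 x
    have hz := ConcreteCategory.congr_hom e1 z
    have hx' : x = ((mappingCone.inl (y • 𝟙 C)).v (n+1) n (by simp)).hom (((mappingCone.fst (y • 𝟙 C)).1.v n (n + 1) rfl).hom x) + ((mappingCone.inr (y • 𝟙 C)).f n).hom (((mappingCone.snd (y • 𝟙 C)).v n n (add_zero n)).hom x) := hx.symm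
    have hz' : z = ((mappingCone.inl (y • 𝟙 C)).v (n+1) n (by simp)).hom (((mappingCone.fst (y • 𝟙 C)).1.v n (n + 1) rfl).hom z) + ((mappingCone.inr (y • 𝟙 C)).f n).hom (((mappingCone.snd (y • 𝟙 C)).v n n (add_zero n)).hom z) := hz.symm
    rw [hx', hz', h.1, h.2]
  · rintro ⟨u, v⟩
    refine ⟨((mappingCone.inl (y • 𝟙 C)).v (n+1) n (by simp)).hom u + ((mappingCone.inr (y • 𝟙 C)).f n).hom v, ?_⟩
    have b1 := ConcreteCategory.congr_hom a1 u
    have b2 := ConcreteCategory.congr_hom a2 u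
    have b3 := ConcreteCategory.congr_hom a3 v
    have b4 := ConcreteCategory.congr_hom a4 v
    refine Prod.ext ?_ ?_
    · refine (map_add _ _ _).trans ?_
      refine (congrArg₂ (· + ·) b1 b3).trans (add_zero _)
    · refine (map_add _ _ _).trans ?_
      refine (congrArg₂ (· + ·) b2 b4).trans (zero_add _)

theorem exact_of_pairs {R : Type*} [CommRing R] {M₁ M₂ M₃ A₁ A₂ A₃ B₁ B₂ B₃ : Type*}
    [AddCommGroup M₁] [AddCommGroup M₂] [AddCommGroup M₃]
    [AddCommGroup A₁] [AddCommGroup A₂] [AddCommGroup A₃]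
    [AddCommGroup B₁] [AddCommGroup B₂] [AddCommGroup B₃]
    [Module R M₁] [Module R M₂] [Module R M₃] [Module R A₁] [Module R A₂] [Module R A₃]
    [Module R B₁] [Module R B₂] [Module R B₃]
    (p₁ : M₁ →ₗ[R] A₁) (p₂ : M₂ →ₗ[R] A₂) (p₃ : M₃ →ₗ[R] A₃)
    (q₁ : M₁ →ₗ[R] B₁) (q₂ : M₂ →ₗ[R] B₂) (q₃ : M₃ →ₗ[R] B₃)
    (h₁ : Function.Bijective fun x => (p₁ x, q₁ x))
    (h₂ : Function.Bijective fun x => (p₂ x, q₂ x))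
    (h₃ : Function.Bijective fun x => (p₃ x, q₃ x))
    (F : M₁ →ₗ[R] M₂) (G : M₂ →ₗ[R] M₃) (f : A₁ →ₗ[R] A₂) (g : A₂ →ₗ[R] A₃)
    (f' : B₁ →ₗ[R] B₂) (g' : B₂ →ₗ[R] B₃)
    (c₁ : ∀ x, p₂ (F x) = f (p₁ x)) (c₂ : ∀ x, p₃ (G x) = g (p₂ x))
    (c₃ : ∀ x, q₂ (F x) = f' (q₁ x)) (c₄ : ∀ x, q₃ (G x) = g' (q₂ x))
    (hf : Function.Injective f) (hg : Function.Surjective g) (e : Function.Exact f g)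
    (hf' : Function.Injective f') (hg' : Function.Surjective g') (e' : Function.Exact f' g') :
    Function.Injective F ∧ Function.Surjective G ∧ Function.Exact F G := by
  refine ⟨fun x z h => ?_, fun x => ?_, fun x => ⟨fun h => ?_, ?_⟩⟩
  · apply h₁.1
    refine Prod.ext (hf ?_) (hf' ?_)
    · simp only [← c₁, h]
    · simp only [← c₃, h]
  · obtain ⟨a, ha⟩ := hg (p₃ x)
    obtain ⟨b, hb⟩ := hg' (q₃ x)
    obtain ⟨w, hw⟩ := h₂.2 (a, b)
    simp only [Prod.mk.injEq] at hw
    refine ⟨w, h₃.1 ?_⟩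
    simp [c₂, c₄, hw.1, hw.2, ha, hb]
  · obtain ⟨a, ha⟩ := (e (p₂ x)).1 (by rw [← c₂, h, map_zero])
    obtain ⟨b, hb⟩ := (e' (q₂ x)).1 (by rw [← c₄, h, map_zero])
    obtain ⟨w, hw⟩ := h₁.2 (a, b)
    simp only [Prod.mk.injEq] at hw
    refine ⟨w, h₂.1 ?_⟩
    simp [c₁, c₃, hw.1, hw.2, ha, hb]
  · rintro ⟨w, rfl⟩
    apply h₃.1
    simp [c₁, c₂, c₃, c₄, e.apply_apply_eq_zero, e'.apply_apply_eq_zero]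

/-- Degreewise short exactness of a pair of maps of complexes. -/
structure DegEx {A B C : CCx R} (f : A ⟶ B) (g : B ⟶ C) : Prop where
  inj : ∀ n, Function.Injective (f.f n).hom
  surj : ∀ n, Function.Surjective (g.f n).hom
  ex : ∀ n, Function.Exact (f.f n).hom (g.f n).hom

theorem DegEx.zero {A B C : CCx R} {f : A ⟶ B} {g : B ⟶ C} (h : DegEx f g) : f ≫ g = 0 := by
  ext n x
  exact (h.ex n).apply_apply_eq_zero x

theorem DegEx.shortExact {A B C : CCx R} {f : A ⟶ B} {g : B ⟶ C} (h : DegEx f g) :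
    (ShortComplex.mk f g h.zero).ShortExact := by
  refine shortExact_of_degreewise_shortExact _ fun n => ?_
  have h1 : ((ShortComplex.mk f g h.zero).map (eval _ _ n)).Exact := by
    rw [ShortComplex.ShortExact.moduleCat_exact_iff_function_exact]
    exact h.ex n
  exact { exact := h1
          mono_f := (ModuleCat.mono_iff_injective _).2 (h.inj n)
          epi_g := (ModuleCat.epi_iff_surjective _).2 (h.surj n) }

theorem DegEx.coneMap (y : R) {A B C : CCx R} {f : A ⟶ B} {g : B ⟶ C} (h : DegEx f g) :
    DegEx (_root_.coneMap y f) (_root_.coneMap y g) := by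
  have key n := exact_of_pairs _ _ _ _ _ _ (cone_bij y A n) (cone_bij y B n) (cone_bij y C n)
    ((_root_.coneMap y f).f n).hom ((_root_.coneMap y g).f n).hom
    (f.f (n + 1)).hom (g.f (n + 1)).hom (f.f n).hom (g.f n).hom
    (ConcreteCategory.congr_hom (coneMap_fst y f n)) (ConcreteCategory.congr_hom (coneMap_fst y g n))
    (ConcreteCategory.congr_hom (coneMap_snd y f n)) (ConcreteCategory.congr_hom (coneMap_snd y g n))
    (h.inj _) (h.surj _) (h.ex _) (h.inj _) (h.surj _) (h.ex _)
  exact ⟨fun n => (key n).1, fun n => (key n).2.1, fun n => (key n).2.2⟩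

theorem DegEx.kz (ys : List R) {A B C : CCx R} {f : A ⟶ B} {g : B ⟶ C} (h : DegEx f g) :
    DegEx ((_root_.kz ys).map f) ((_root_.kz ys).map g) := by
  induction ys with
  | nil => exact h
  | cons y ys ih => exact ih.coneMap y

theorem coneF_quasiIso (y : R) {C D : CCx R} (f : C ⟶ D) [QuasiIso f] :
    QuasiIso ((coneF y).map f) := by
  let := HasDerivedCategory.standard (ModuleCat.{u} R)
  rw [← DerivedCategory.isIso_Q_map_iff_quasiIso]
  have : IsIso (DerivedCategory.Q.map f) := by
    rw [DerivedCategory.isIso_Q_map_iff_quasiIso]; infer_instance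
  let φ := DerivedCategory.Q.mapTriangle.map
    (mappingCone.triangleMap (y • 𝟙 C) (y • 𝟙 D) f f (by simp))
  exact Pretriangulated.isIso₃_of_isIso₁₂ φ
    (DerivedCategory.mappingCone_triangle_distinguished _)
    (DerivedCategory.mappingCone_triangle_distinguished _) this
      this

theorem kz_quasiIso (ys : List R) {C D : CCx R} (f : C ⟶ D) [QuasiIso f] :
    QuasiIso ((kz ys).map f) := by
  induction ys with
  | nil => assumption
  | cons y ys ih => exact coneF_quasiIso y _

theorem homologyMap_smul' {C D : CCx R} (f : C ⟶ D) (y : R) (n : ℤ) :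
    homologyMap (y • f) n = y • homologyMap f n := by
  exact ShortComplex.homologyMap_smul ((shortComplexFunctor _ _ n).map f) y

/-- Finiteness of the homology of a cone. -/
theorem cone_exact (y : R) (C : CCx R) (n : ℤ) :
    ∃ (f : C.homology n →ₗ[R] ((coneF y).obj C).homology n)
      (g : ((coneF y).obj C).homology n →ₗ[R] C.homology (n + 1)),
      Function.Exact (y • LinearMap.id : C.homology n →ₗ[R] C.homology n) f ∧
      Function.Exact f g ∧
      Function.Exact g (y • LinearMap.id : C.homology (n + 1) →ₗ[R] C.homology (n + 1)) := by
  let := HasDerivedCategory.standard (ModuleCat.{u} R)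
  let T := mappingCone.triangle (y • 𝟙 C)
  have hT := DerivedCategory.mappingCone_triangle_distinguished (y • 𝟙 C)
  have e : ∀ n, (homologyMap T.mor₁ n).hom = y • LinearMap.id := by
    intro n
    change (homologyMap (y • 𝟙 C) n).hom = _
    rw [homologyMap_smul', homologyMap_id]
    rfl
  have h1 := homologyMap_exact₂_of_distTriang T hT n
  have h2 := homologyMap_exact₃_of_distTriang T hT n (n + 1) rfl
  have h3 := homologyMap_exact₁_of_distTriang T hT n (n + 1) rfl
  rw [ShortComplex.ShortExact.moduleCat_exact_iff_function_exact] at h1 h2 h3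
  refine ⟨(homologyMap T.mor₂ n).hom, (homologyδOfTriangle T n (n + 1) rfl).hom, ?_, h2, ?_⟩
  · have h1' : Function.Exact (homologyMap T.mor₁ n).hom (homologyMap T.mor₂ n).hom := h1
    rw [e] at h1'; exact h1'
  · have h3' : Function.Exact (homologyδOfTriangle T n (n + 1) rfl).hom (homologyMap T.mor₁ (n + 1)).hom := h3
    rw [e] at h3'; exact h3'

end Cone


section FinHom

open CochainComplex HomologicalComplex

variable {R : Type u} [CommRing R]

theorem finite_of_exact3 [IsNoetherianRing R] {A B C : Type*} [AddCommGroup A] [AddCommGroup B] [AddCommGroup C]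
    [Module R A] [Module R B] [Module R C] (f : A →ₗ[R] B) (g : B →ₗ[R] C)
    (e : Function.Exact f g) (hA : Module.Finite R A) (hC : Module.Finite R C) :
    Module.Finite R B := by
  have : Module.Finite R (LinearMap.range g) := inferInstance
  have : Module.Finite R (LinearMap.ker g) := by
    rw [e.linearMap_ker_eq]; infer_instance
  have : Module.Finite R (B ⧸ LinearMap.ker g) := Module.Finite.equiv g.quotKerEquivRange.symm
  exact Module.Finite.of_submodule_quotient (LinearMap.ker g)

theorem finite_iff_of_exact5 [IsNoetherianRing R] (y : R) {A E B : Type*}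
    [AddCommGroup A] [AddCommGroup E] [AddCommGroup B]
    [Module R A] [Module R E] [Module R B] (f : A →ₗ[R] E) (g : E →ₗ[R] B)
    (h1 : Function.Exact (y • LinearMap.id : A →ₗ[R] A) f) (h2 : Function.Exact f g)
    (h3 : Function.Exact g (y • LinearMap.id : B →ₗ[R] B)) :
    Module.Finite R E ↔
      Module.Finite R (A ⧸ LinearMap.range (y • LinearMap.id : A →ₗ[R] A)) ∧
      Module.Finite R (LinearMap.ker (y • LinearMap.id : B →ₗ[R] B)) := by
  rw [← h1.linearMap_ker_eq, h3.linearMap_ker_eq]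
  constructor
  · intro h
    refine ⟨?_, inferInstance⟩
    exact Module.Finite.equiv f.quotKerEquivRange.symm
  · rintro ⟨a, b⟩
    have : Module.Finite R (LinearMap.ker g) := by
      rw [h2.linearMap_ker_eq]
      exact Module.Finite.equiv f.quotKerEquivRange
    have : Module.Finite R (E ⧸ LinearMap.ker g) := Module.Finite.equiv g.quotKerEquivRange.symm
    exact Module.Finite.of_submodule_quotient (LinearMap.ker g)

theorem cone_finite_iff [IsNoetherianRing R] (y : R) (C : CCx R) (n : ℤ) :
    Module.Finite R (((coneF y).obj C).homology n) ↔
      Module.Finite R (C.homology n ⧸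
        LinearMap.range (y • LinearMap.id : C.homology n →ₗ[R] C.homology n)) ∧
      Module.Finite R (LinearMap.ker
        (y • LinearMap.id : C.homology (n + 1) →ₗ[R] C.homology (n + 1))) := by
  obtain ⟨f, g, h1, h2, h3⟩ := cone_exact y C n
  exact finite_iff_of_exact5 y f g h1 h2 h3

theorem cone_finite [IsNoetherianRing R] (y : R) (C : CCx R) (n : ℤ)
    (h : Module.Finite R (C.homology n)) (h' : Module.Finite R (C.homology (n + 1))) :
    Module.Finite R (((coneF y).obj C).homology n) := by
  rw [cone_finite_iff]
  exact ⟨inferInstance, inferInstance⟩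

theorem hmap_smul_id (C : CCx R) (y : R) (n : ℤ) :
    (homologyMap (y • 𝟙 C) n).hom = y • LinearMap.id := by
  rw [homologyMap_smul', homologyMap_id]
  rfl

theorem cone_finite_down [IsNoetherianRing R] (y : R) (C : CCx R) (n : ℤ) (hy : y • 𝟙 C = 0)
    (h : Module.Finite R (((coneF y).obj C).homology n)) : Module.Finite R (C.homology n) := by
  rw [cone_finite_iff] at h
  have h1 := h.1
  have e : (y • LinearMap.id : C.homology n →ₗ[R] C.homology n) = 0 := by
    rw [← hmap_smul_id, hy, homologyMap_zero]; rfl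
  rw [e, LinearMap.range_zero] at h1
  exact Module.Finite.equiv (Submodule.quotEquivOfEqBot ⊥ rfl)

namespace DegEx

variable {A B C : CCx R} {f : A ⟶ B} {g : B ⟶ C}

theorem ex2 (h : DegEx f g) (n : ℤ) :
    Function.Exact (homologyMap f n).hom (homologyMap g n).hom := by
  have := h.shortExact.homology_exact₂ n
  rw [ShortComplex.ShortExact.moduleCat_exact_iff_function_exact] at this
  exact this

theorem ex3 (h : DegEx f g) (n : ℤ) : ∃ δ : C.homology n →ₗ[R] A.homology (n + 1),
    Function.Exact (homologyMap g n).hom δ ∧ Function.Exact δ (homologyMap f (n + 1)).hom := by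
  have h3 := h.shortExact.homology_exact₃ n (n + 1) (by simp)
  have h1 := h.shortExact.homology_exact₁ n (n + 1) (by simp)
  rw [ShortComplex.ShortExact.moduleCat_exact_iff_function_exact] at h1 h3
  exact ⟨_, h3, h1⟩

theorem reg_left [IsNoetherianRing R] {y : R} {g : A ⟶ C} (h : DegEx (y • 𝟙 A) g) (n : ℤ)
    (hf : Module.Finite R (C.homology n)) :
    Module.Finite R (((coneF y).obj A).homology n) := by
  rw [cone_finite_iff]
  obtain ⟨δ, h3, h1⟩ := h.ex3 n
  have h2 := h.ex2 n
  rw [hmap_smul_id] at h1 h2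
  exact (finite_iff_of_exact5 y _ _ h2 h3 h1).1 hf

theorem reg_right [IsNoetherianRing R] {y : R} {g : C ⟶ A} (h : DegEx g (y • 𝟙 A)) (n : ℤ)
    (hf : Module.Finite R (C.homology (n + 1))) :
    Module.Finite R (((coneF y).obj A).homology n) := by
  rw [cone_finite_iff]
  obtain ⟨δ, h3, h1⟩ := h.ex3 n
  have h2 := h.ex2 (n + 1)
  rw [hmap_smul_id] at h3 h2
  exact (finite_iff_of_exact5 y _ _ h3 h1 h2).1 hf

end DegEx

theorem subsingleton_homology (C : CCx R) (h : 𝟙 C = 0) (n : ℤ) : Subsingleton (C.homology n) := by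
  have : homologyMap (𝟙 C) n = 0 := by rw [h, homologyMap_zero]
  rw [homologyMap_id] at this
  exact ⟨fun a b => (ConcreteCategory.congr_hom this a).trans
    (ConcreteCategory.congr_hom this b).symm⟩

theorem finite_homology_of_iso {C D : CCx R} (e : C ≅ D) (n : ℤ)
    (h : Module.Finite R (C.homology n)) : Module.Finite R (D.homology n) :=
  have e' : C.homology n ≃ₗ[R] D.homology n :=
    (show C.homology n ≅ D.homology n from (homologyFunctor _ _ n).mapIso e).toLinearEquiv
  Module.Finite.equiv e'

/-- Covariant data. -/
structure CovData (F : ModuleCat.{u} R ⥤ CCx R) : Prop where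
  smul : ∀ {M N : ModuleCat.{u} R} (r : R) (f : M ⟶ N), F.map (r • f) = r • F.map f
  ex : ∀ {A B C : ModuleCat.{u} R} (f : A ⟶ B) (g : B ⟶ C), Function.Injective f.hom →
    Function.Surjective g.hom → Function.Exact f.hom g.hom → DegEx (F.map f) (F.map g)
  bdd : ∀ (M : ModuleCat.{u} R) (i : ℤ), 0 < i → Subsingleton ((F.obj M).homology i)

theorem CovData.kdata [IsNoetherianRing R] {F : ModuleCat.{u} R ⥤ CCx R} (H : CovData F) :
    KData R (fun ys i M _ _ => Module.Finite R
      (((kz ys).obj (F.obj (ModuleCat.of R M))).homology i)) where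
  iso ys i A B _ _ _ _ e h :=
    finite_homology_of_iso ((kz ys).mapIso (F.mapIso e.toModuleIso)) i h
  zero ys i A _ _ hA := by
    have : 𝟙 ((kz ys).obj (F.obj (ModuleCat.of R A))) = 0 := by
      have : 𝟙 (ModuleCat.of R A) = (0 : R) • 𝟙 (ModuleCat.of R A) := by
        ext x; exact Subsingleton.elim _ _
      rw [← CategoryTheory.Functor.map_id, ← CategoryTheory.Functor.map_id, this, H.smul, kz_smul, zero_smul]
    have := subsingleton_homology _ this i
    infer_instance
  mid ys i A B C _ _ _ _ _ _ f g hf hg e hA hC :=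
    finite_of_exact3 _ _ (((H.ex (ModuleCat.ofHom f) (ModuleCat.ofHom g) hf hg e).kz ys).ex2 i) hA hC
  right ys i A B C _ _ _ _ _ _ f g hf hg e hB hA := by
    obtain ⟨δ, h3, -⟩ := ((H.ex (ModuleCat.ofHom f) (ModuleCat.ofHom g) hf hg e).kz ys).ex3 i
    exact finite_of_exact3 _ _ h3 hB hA
  up y ys A _ _ h i := cone_finite y _ i (h i) (h (i + 1))
  down y ys A _ _ hy h i := by
    refine cone_finite_down y _ i ?_ (h i)
    have : y • 𝟙 (ModuleCat.of R A) = (0 : R) • 𝟙 (ModuleCat.of R A) := by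
      ext x
      exact (hy x).trans (zero_smul R x).symm
    rw [← CategoryTheory.Functor.map_id, ← CategoryTheory.Functor.map_id, ← kz_smul, ← H.smul, this, H.smul, kz_smul, zero_smul]
  reg y ys A C _ _ _ _ g hy hg e h i := by
    have := (H.ex (y • 𝟙 (ModuleCat.of R A)) (ModuleCat.ofHom g) hy hg e).kz ys
    rw [H.smul, kz_smul, CategoryTheory.Functor.map_id, CategoryTheory.Functor.map_id] at this
    exact this.reg_left i (h i)
  bdd ys := by
    refine ⟨0, ?_⟩
    intro A _ _
    induction ys with
    | nil => intro i hi; have := H.bdd (ModuleCat.of R A) i hi; exact inferInstanceAs (Module.Finite R ((F.obj (ModuleCat.of R A)).homology i))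
    | cons y ys ih => intro i hi; exact cone_finite y _ i (ih i hi) (ih (i + 1) (by omega))

/-- Contravariant data. -/
structure ContraData (F : (ModuleCat.{u} R)ᵒᵖ ⥤ CCx R) : Prop where
  smul : ∀ {M N : ModuleCat.{u} R} (r : R) (f : M ⟶ N), F.map (r • f).op = r • F.map f.op
  ex : ∀ {A B C : ModuleCat.{u} R} (f : A ⟶ B) (g : B ⟶ C), Function.Injective f.hom →
    Function.Surjective g.hom → Function.Exact f.hom g.hom → DegEx (F.map g.op) (F.map f.op)
  bdd : ∀ (M : ModuleCat.{u} R) (i : ℤ), i < 0 → Subsingleton ((F.obj (.op M)).homology i)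

theorem ContraData.kdata [IsNoetherianRing R] {F : (ModuleCat.{u} R)ᵒᵖ ⥤ CCx R}
    (H : ContraData F) :
    KData R (fun ys i M _ _ => Module.Finite R
      (((kz ys).obj (F.obj (.op (ModuleCat.of R M)))).homology (-i))) where
  iso ys i A B _ _ _ _ e h :=
    finite_homology_of_iso ((kz ys).mapIso (F.mapIso e.symm.toModuleIso.op)) _ h
  zero ys i A _ _ hA := by
    have : 𝟙 ((kz ys).obj (F.obj (.op (ModuleCat.of R A)))) = 0 := by
      have : 𝟙 (ModuleCat.of R A) = (0 : R) • 𝟙 (ModuleCat.of R A) := by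
        ext x; exact Subsingleton.elim _ _
      rw [← CategoryTheory.Functor.map_id, ← CategoryTheory.Functor.map_id, ← op_id, this, H.smul, kz_smul, zero_smul]
    have := subsingleton_homology _ this (-i)
    infer_instance
  mid ys i A B C _ _ _ _ _ _ f g hf hg e hA hC :=
    finite_of_exact3 _ _
      (((H.ex (ModuleCat.ofHom f) (ModuleCat.ofHom g) hf hg e).kz ys).ex2 (-i)) hC hA
  right ys i A B C _ _ _ _ _ _ f g hf hg e hB hA := by
    obtain ⟨δ, -, h3⟩ :=
      ((H.ex (ModuleCat.ofHom f) (ModuleCat.ofHom g) hf hg e).kz ys).ex3 (-(i + 1))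
    have hi : -(i + 1) + 1 = -i := by omega
    have := fun h => finite_of_exact3 _ _ h3 hA h
    rw [hi] at this
    exact this hB
  up y ys A _ _ h i := cone_finite y _ (-i) (h i) (by
    have := h (i - 1)
    rwa [show -(i - 1) = -i + 1 by omega] at this)
  down y ys A _ _ hy h i := by
    refine cone_finite_down y _ (-i) ?_ (h i)
    have : y • 𝟙 (ModuleCat.of R A) = (0 : R) • 𝟙 (ModuleCat.of R A) := by
      ext x
      exact (hy x).trans (zero_smul R x).symm
    rw [← CategoryTheory.Functor.map_id, ← CategoryTheory.Functor.map_id, ← kz_smul, ← op_id, ← H.smul, this, H.smul,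
      kz_smul, zero_smul]
  reg y ys A C _ _ _ _ g hy hg e h i := by
    have := (H.ex (y • 𝟙 (ModuleCat.of R A)) (ModuleCat.ofHom g) hy hg e).kz ys
    rw [H.smul, kz_smul, op_id, CategoryTheory.Functor.map_id, CategoryTheory.Functor.map_id] at this
    refine this.reg_right (-i) ?_
    have := h (i - 1)
    rwa [show -(i - 1) = -i + 1 by omega] at this
  bdd ys := by
    have key : ∃ N : ℤ, ∀ (A : Type u) [AddCommGroup A] [Module R A] (i : ℤ), i < -N →
      Module.Finite R (((kz ys).obj (F.obj (.op (ModuleCat.of R A)))).homology i) := by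
      induction ys with
      | nil =>
        refine ⟨0, fun A _ _ i hi => ?_⟩
        have := H.bdd (ModuleCat.of R A) i (by simpa using hi)
        exact inferInstanceAs (Module.Finite R ((F.obj (.op (ModuleCat.of R A))).homology i))
      | cons y ys ih =>
        obtain ⟨N, hN⟩ := ih
        exact ⟨N + 1, fun A _ _ i hi =>
          cone_finite y _ i (hN A i (by omega)) (hN A (i + 1) (by omega))⟩
    obtain ⟨N, hN⟩ := key
    exact ⟨N, fun A _ _ i hi => hN A (-i) (by omega)⟩

end FinHom


section Ext0

open CochainComplex HomologicalComplex

variable {R : Type u} [CommRing R]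
variable {J : Type*} [Category J] (G : J ⥤ ModuleCat.{u} R ⥤ ModuleCat.{u} R)
  [∀ M, (G.obj M).Additive] {ι : Type} {c : ComplexShape ι}
  (C : HomologicalComplex (ModuleCat.{u} R) c) (e : c.Embedding (ComplexShape.up ℤ))

/-- Apply a bifunctor to a fixed complex and extend to a cochain complex indexed by `ℤ`. -/
def gF : J ⥤ CCx R where
  obj M := (((G.obj M).mapHomologicalComplex c).obj C).extend e
  map f := extendMap ((NatTrans.mapHomologicalComplex (G.map f) c).app C) e
  map_id M := by
    rw [CategoryTheory.Functor.map_id, NatTrans.mapHomologicalComplex_id]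
    exact extendMap_id _ _
  map_comp f g := by
    rw [CategoryTheory.Functor.map_comp, NatTrans.mapHomologicalComplex_comp]
    exact extendMap_comp _ _ _

theorem smul_mid_comp {A B D E : ModuleCat.{u} R} (r : R) (a : A ⟶ B) (b b' : B ⟶ D) (d : D ⟶ E)
    (h : b' = r • b) : a ≫ b' ≫ d = r • (a ≫ b ≫ d) := by
  rw [h, Linear.smul_comp, Linear.comp_smul]

theorem gF_smul {M N : J} (f f' : M ⟶ N) (r : R)
    (h : ∀ X, (G.map f').app X = r • (G.map f).app X) :
    (gF G C e).map f' = r • (gF G C e).map f := by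
  ext1 n
  rw [HomologicalComplex.smul_f_apply]
  by_cases hn : ∃ i, e.f i = n
  · obtain ⟨i, hi⟩ := hn
    refine (extendMap_f _ e hi).trans ?_
    refine Eq.trans ?_ (congrArg (r • ·) (extendMap_f _ e hi)).symm
    exact smul_mid_comp r _ _ _ _ (h _)
  · push Not at hn
    exact (isZero_extend_X _ e n hn).eq_of_src _ _

theorem exact_of_equivs {R : Type*} [CommRing R] {M₁ M₂ M₃ A₁ A₂ A₃ : Type*}
    [AddCommGroup M₁] [AddCommGroup M₂] [AddCommGroup M₃]
    [AddCommGroup A₁] [AddCommGroup A₂] [AddCommGroup A₃]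
    [Module R M₁] [Module R M₂] [Module R M₃] [Module R A₁] [Module R A₂] [Module R A₃]
    (a1 : M₁ ≃ₗ[R] A₁) (a2 : M₂ ≃ₗ[R] A₂) (a3 : M₃ ≃ₗ[R] A₃)
    (F : M₁ →ₗ[R] M₂) (G : M₂ →ₗ[R] M₃) (f : A₁ →ₗ[R] A₂) (g : A₂ →ₗ[R] A₃)
    (c1 : ∀ x, a2 (F x) = f (a1 x)) (c2 : ∀ x, a3 (G x) = g (a2 x))
    (hi : Function.Injective f) (hs : Function.Surjective g) (he : Function.Exact f g) :
    Function.Injective F ∧ Function.Surjective G ∧ Function.Exact F G := by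
  refine ⟨fun x z h => ?_, fun x => ?_, fun x => ⟨fun h => ?_, ?_⟩⟩
  · apply a1.injective
    apply hi
    rw [← c1, ← c1, h]
  · obtain ⟨w, hw⟩ := hs (a3 x)
    refine ⟨a2.symm w, a3.injective ?_⟩
    rw [c2, LinearEquiv.apply_symm_apply, hw]
  · obtain ⟨w, hw⟩ := (he (a2 x)).1 (by rw [← c2, h, map_zero])
    refine ⟨a1.symm w, a2.injective ?_⟩
    rw [c1, LinearEquiv.apply_symm_apply, hw]
  · rintro ⟨w, rfl⟩
    apply a3.injective
    rw [c2, c1, he.apply_apply_eq_zero, map_zero]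

theorem gF_degEx {A B D : J} (f : A ⟶ B) (g : B ⟶ D)
    (hi : ∀ i, Function.Injective ((G.map f).app (C.X i)).hom)
    (hs : ∀ i, Function.Surjective ((G.map g).app (C.X i)).hom)
    (he : ∀ i, Function.Exact ((G.map f).app (C.X i)).hom ((G.map g).app (C.X i)).hom) :
    DegEx ((gF G C e).map f) ((gF G C e).map g) := by
  have key n : Function.Injective (((gF G C e).map f).f n).hom ∧
      Function.Surjective (((gF G C e).map g).f n).hom ∧
      Function.Exact (((gF G C e).map f).f n).hom (((gF G C e).map g).f n).hom := by
    by_cases hn : ∃ i, e.f i = n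
    · obtain ⟨i, hi'⟩ := hn
      have e1 := extendMap_f ((NatTrans.mapHomologicalComplex (G.map f) c).app C) e hi'
      have e2 := extendMap_f ((NatTrans.mapHomologicalComplex (G.map g) c).app C) e hi'
      let a1 : ((gF G C e).obj A).X n ≃ₗ[R] (G.obj A).obj (C.X i) :=
        (extendXIso (((G.obj A).mapHomologicalComplex c).obj C) e hi').toLinearEquiv
      let a2 : ((gF G C e).obj B).X n ≃ₗ[R] (G.obj B).obj (C.X i) :=
        (extendXIso (((G.obj B).mapHomologicalComplex c).obj C) e hi').toLinearEquiv
      let a3 : ((gF G C e).obj D).X n ≃ₗ[R] (G.obj D).obj (C.X i) :=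
        (extendXIso (((G.obj D).mapHomologicalComplex c).obj C) e hi').toLinearEquiv
      exact exact_of_equivs a1 a2 a3 _ _ _ _
        (fun x => (LinearEquiv.eq_symm_apply a2).1 (ConcreteCategory.congr_hom e1 x))
        (fun x => (LinearEquiv.eq_symm_apply a3).1 (ConcreteCategory.congr_hom e2 x))
        (hi i) (hs i) (he i)
    · push Not at hn
      have z1 : Subsingleton (((gF G C e).obj A).X n) :=
        ModuleCat.subsingleton_of_isZero (isZero_extend_X _ e n hn)
      have z2 : Subsingleton (((gF G C e).obj B).X n) :=
        ModuleCat.subsingleton_of_isZero (isZero_extend_X _ e n hn)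
      have z3 : Subsingleton (((gF G C e).obj D).X n) :=
        ModuleCat.subsingleton_of_isZero (isZero_extend_X _ e n hn)
      exact ⟨fun x z _ => Subsingleton.elim _ _, fun x => ⟨0, Subsingleton.elim _ _⟩,
        fun x => ⟨fun _ => ⟨0, Subsingleton.elim _ _⟩, fun _ => Subsingleton.elim _ _⟩⟩
  exact ⟨fun n => (key n).1, fun n => (key n).2.1, fun n => (key n).2.2⟩

theorem gF_zero (M : J) (n : ℤ) (hn : ∀ i, e.f i ≠ n) :
    Subsingleton (((gF G C e).obj M).homology n) :=
  ModuleCat.subsingleton_of_isZero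
    ((exactAt_iff_isZero_homology _ _).1 (extend_exactAt _ e n hn))

theorem gF_homology [e.IsRelIff] (M : J) (n : ℤ) (i : ι) (hn : e.f i = n) :
    Nonempty (((gF G C e).obj M).homology n ≃ₗ[R]
      (((G.obj M).mapHomologicalComplex c).obj C).homology i) :=
  ⟨((((G.obj M).mapHomologicalComplex c).obj C).extendHomologyIso e hn).toLinearEquiv⟩

theorem gF_unit (M : J) (α : G.obj M ≅ 𝟭 _) : Nonempty ((gF G C e).obj M ≅ C.extend e) :=
  ⟨(e.extendFunctor _).mapIso ((NatIso.mapHomologicalComplex α c).app C ≪≫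
    (Functor.mapHomologicalComplexIdIso _ c).app C)⟩

end Ext0

section TorI

open CochainComplex HomologicalComplex MonoidalCategory

variable {R : Type u} [CommRing R] {X : ModuleCat.{u} R} (P : ProjectiveResolution X)

/-- The complex computing Tor. -/
def torF : ModuleCat.{u} R ⥤ CCx R :=
  gF (tensoringLeft (ModuleCat.{u} R)) P.complex ComplexShape.embeddingDownNat

theorem torF_cov : CovData (torF P) where
  smul r f := by
    refine gF_smul _ _ _ _ _ _ fun X => ?_
    ext x : 1
    exact TensorProduct.map_smul_left _ _ _
  ex f g hf hg he := by
    have hflat (i) : Module.Flat R (P.complex.X i) := by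
      have : Module.Projective R (P.complex.X i) :=
        (IsProjective.iff_projective _).2 (P.projective i)
      infer_instance
    refine gF_degEx _ _ _ _ _ (fun i => ?_) (fun i => ?_) (fun i => ?_)
    · exact Module.Flat.rTensor_preserves_injective_linearMap f.hom hf
    · exact LinearMap.rTensor_surjective _ hg
    · exact rTensor_exact _ he hg
  bdd M i hi := gF_zero _ _ _ _ _ fun j => by simp; omega

theorem torF_homology (M : ModuleCat.{u} R) (i : ℕ) :
    Nonempty (((torF P).obj M).homology (-i) ≃ₗ[R] ((Tor (ModuleCat.{u} R) i).obj M).obj X) := by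
  obtain ⟨e⟩ := gF_homology (tensoringLeft (ModuleCat.{u} R)) P.complex
    ComplexShape.embeddingDownNat M (-i) i (by simp)
  exact ⟨e.trans (P.isoLeftDerivedObj ((tensoringLeft (ModuleCat.{u} R)).obj M) i).symm.toLinearEquiv⟩

theorem torF_unit : Nonempty ((torF P).obj (ModuleCat.of R R) ≅ P.cochainComplex) :=
  gF_unit _ _ _ _ (leftUnitorNatIso (ModuleCat.{u} R))

theorem koszul_iff_tor [IsNoetherianRing R] (a : Ideal R) (y : List R) (hy : Ideal.span {r : R | r ∈ y} = a)
    (X : ModuleCat.{u} R) :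
    (∀ i : ℤ, Module.Finite R ((koszulTensor R X y).homology i)) ↔
      (∀ i : ℕ, Module.Finite R
        (((Tor (ModuleCat.{u} R) i).obj (ModuleCat.of R (R ⧸ a))).obj X)) := by
  let P := projectiveResolution X
  have key := (torF_cov P).kdata.equiv a y hy
  obtain ⟨u⟩ := torF_unit P
  rw [koszulTensor_eq]
  have q := kz_quasiIso y P.π'
  have h1 : (∀ i : ℤ, Module.Finite R (((kz y).obj
      ((HomologicalComplex.single (ModuleCat.{u} R) (ComplexShape.up ℤ) 0).obj X)).homology i)) ↔
      ∀ i : ℤ, Module.Finite R (((kz y).obj ((torF P).obj (ModuleCat.of R R))).homology i) := by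
    refine forall_congr' fun i => ?_
    have e1 := (asIso (homologyMap ((kz y).map P.π') i)).toLinearEquiv
    have e2 : ((kz y).obj ((torF P).obj (ModuleCat.of R R))).homology i ≅
      ((kz y).obj P.cochainComplex).homology i := (homologyFunctor _ _ i).mapIso ((kz y).mapIso u)
    exact (Module.Finite.equiv_iff (e2.toLinearEquiv.trans e1)).symm
  refine h1.trans (key.trans ?_)
  change (∀ i : ℤ, Module.Finite R (((torF P).obj (ModuleCat.of R (R ⧸ a))).homology i)) ↔ _
  constructor
  · intro h i
    obtain ⟨e⟩ := torF_homology P (ModuleCat.of R (R ⧸ a)) i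
    have := h (-i)
    exact Module.Finite.equiv e
  · intro h i
    by_cases hi : 0 < i
    · have := (torF_cov P).bdd (ModuleCat.of R (R ⧸ a)) i hi
      infer_instance
    · obtain ⟨j, rfl⟩ := Int.exists_eq_neg_ofNat (not_lt.1 hi)
      obtain ⟨e⟩ := torF_homology P (ModuleCat.of R (R ⧸ a)) j
      have := h j
      exact Module.Finite.equiv e.symm

end TorI


section ExtI

open CochainComplex HomologicalComplex

variable {R : Type u} [CommRing R] {X : ModuleCat.{u} R} (I : InjectiveResolution X)

/-- The complex computing Ext via an injective resolution. -/
def extF : (ModuleCat.{u} R)ᵒᵖ ⥤ CCx R :=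
  gF (linearCoyoneda R (ModuleCat.{u} R)) I.cocomplex ComplexShape.embeddingUpNat

theorem extF_contra : ContraData (extF I) where
  smul r f := by
    refine gF_smul _ _ _ _ _ _ fun X => ?_
    ext x : 2
    exact Linear.smul_comp (R := R) (C := ModuleCat.{u} R) _ _ _ r f _
  ex {A B D} f g hf hg he := by
    refine gF_degEx _ _ _ _ _ (fun i => ?_) (fun i => ?_) (fun i => ?_)
    · have : Epi g := (ModuleCat.epi_iff_surjective _).2 hg
      intro a b (h : g ≫ a = g ≫ b)
      exact (cancel_epi g).1 h
    · have : Mono f := (ModuleCat.mono_iff_injective _).2 hf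
      have := I.injective i
      intro (a : A ⟶ I.cocomplex.X i)
      exact ⟨Injective.factorThru a f, Injective.comp_factorThru a f⟩
    · intro (h : B ⟶ I.cocomplex.X i)
      constructor
      · intro (hh : f ≫ h = 0)
        have hle : LinearMap.ker g.hom ≤ LinearMap.ker h.hom := by
          intro x hx
          obtain ⟨w, rfl⟩ := (he x).1 hx
          exact ConcreteCategory.congr_hom hh w
        refine ⟨ModuleCat.ofHom ((Submodule.liftQ _ h.hom hle) ∘ₗ
          (g.hom.quotKerEquivOfSurjective hg).symm.toLinearMap), ?_⟩
        change g ≫ ModuleCat.ofHom _ = h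
        ext x
        have : (g.hom.quotKerEquivOfSurjective hg).symm (g.hom x) = Submodule.Quotient.mk x := by
          rw [LinearEquiv.symm_apply_eq]; rfl
        change Submodule.liftQ _ h.hom hle ((g.hom.quotKerEquivOfSurjective hg).symm (g.hom x)) = _
        rw [this]; rfl
      · rintro ⟨w, rfl⟩
        have : f ≫ g = 0 := by ext x; exact he.apply_apply_eq_zero x
        have hw (v : D ⟶ I.cocomplex.X i) : f ≫ g ≫ v = 0 := by
          rw [reassoc_of% this, Limits.zero_comp]
        exact hw w
  bdd M i hi := gF_zero _ _ _ _ _ fun j => by simp; omega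

/-- `Hom(R, -)` is the identity. -/
def coyonedaUnit : (linearCoyoneda R (ModuleCat.{u} R)).obj (.op (ModuleCat.of R R)) ≅ 𝟭 _ :=
  NatIso.ofComponents (fun M => (LinearEquiv.toModuleIso
    (X₁ := (ModuleCat.of R R ⟶ M)) (X₂ := M)
    (ModuleCat.homLinearEquiv.trans (LinearMap.ringLmapEquivSelf R R M)))) (by
      intro M N f
      ext x
      rfl)

theorem extF_unit : Nonempty ((extF I).obj (.op (ModuleCat.of R R)) ≅ I.cochainComplex) :=
  gF_unit _ _ _ _ coyonedaUnit

theorem sc_homology (S : ShortComplex (ModuleCat.{u} R)) {E : Type*} [AddCommGroup E] [Module R E]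
    (φ : LinearMap.ker S.g.hom →ₗ[R] E) (hs : Function.Surjective φ)
    (h : ∀ z, φ z = 0 ↔ ∃ x, S.f.hom x = z.1) : Nonempty (S.homology ≃ₗ[R] E) := by
  have e1 := S.moduleCatHomologyIso.toLinearEquiv
  have e2 := φ.quotKerEquivOfSurjective hs
  refine ⟨e1.trans (LinearEquiv.trans (Submodule.quotEquivOfEq _ _ ?_) e2)⟩
  ext z
  rw [LinearMap.mem_ker, h]
  constructor
  · rintro ⟨x, rfl⟩; exact ⟨x, rfl⟩
  · rintro ⟨x, hx⟩; exact ⟨x, Subtype.ext hx⟩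

theorem cc_homology (K : CochainComplex (ModuleCat.{u} R) ℕ) (n : ℕ) {E : Type*}
    [AddCommGroup E] [Module R E]
    (φ : LinearMap.ker (K.d n (n + 1)).hom →ₗ[R] E) (hs : Function.Surjective φ)
    (h : ∀ p, p + 1 = n → ∀ z, φ z = 0 ↔ ∃ x, (K.d p n).hom x = z.1)
    (h0 : n = 0 → ∀ z, φ z = 0 → z = 0) : Nonempty (K.homology n ≃ₗ[R] E) := by
  cases n with
  | zero =>
    obtain ⟨e⟩ := sc_homology (K.sc' 0 0 1) φ hs (by
      intro z
      constructor
      · intro hz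
        rw [h0 rfl z hz]
        exact ⟨0, map_zero _⟩
      · rintro ⟨x, hx⟩
        have hd : K.d 0 0 = 0 := K.shape _ _ (by simp)
        have : z = 0 := by
          apply Subtype.ext
          rw [← hx]
          change (K.d 0 0).hom x = 0
          rw [hd]; rfl
        rw [this]; exact map_zero φ)
    exact ⟨(ShortComplex.homologyMapIso (K.isoSc' 0 0 1 (by simp) (by simp))).toLinearEquiv.trans e⟩
  | succ p =>
    obtain ⟨e⟩ := sc_homology (K.sc' p (p + 1) (p + 1 + 1)) φ hs (h p rfl)
    exact ⟨(ShortComplex.homologyMapIso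
      (K.isoSc' p (p + 1) (p + 1 + 1) (by simp) (by simp))).toLinearEquiv.trans e⟩

theorem inj_extMk_zero {M : ModuleCat.{u} R} (f : M ⟶ I.cocomplex.X 0)
    (hf : f ≫ I.cocomplex.d 0 (0 + 1) = 0) (h : I.extMk f (0 + 1) rfl hf = 0) : f = 0 := by
  simp only [← I.extEquivCohomologyClass.apply_eq_iff_eq,
    InjectiveResolution.extEquivCohomologyClass_extMk,
    InjectiveResolution.extEquivCohomologyClass_zero,
    HomComplex.CohomologyClass.mk_eq_zero_iff] at h
  rw [HomComplex.Cocycle.fromSingleMk_mem_coboundaries_iff _ _ _ _ _ (-1) (by lia)] at h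
  obtain ⟨g, hg⟩ := h
  have hz : Limits.IsZero (I.cochainComplex.X (-1)) :=
    isZero_extend_X _ _ _ (by intro j; simp)
  rw [hz.eq_of_tgt g 0, Limits.zero_comp] at hg
  rw [← cancel_mono (I.cochainComplexXIso ((0 : ℕ) : ℤ) 0 rfl).inv, ← hg, Limits.zero_comp]

theorem proj_extMk_zero {M X : ModuleCat.{u} R} (P : ProjectiveResolution M)
    (f : P.complex.X 0 ⟶ X)
    (hf : P.complex.d (0 + 1) 0 ≫ f = 0) (h : P.extMk f (0 + 1) rfl hf = 0) : f = 0 := by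
  simp only [← P.extEquivCohomologyClass.apply_eq_iff_eq,
    ProjectiveResolution.extEquivCohomologyClass_extMk,
    ProjectiveResolution.extEquivCohomologyClass_zero,
    HomComplex.CohomologyClass.mk_eq_zero_iff] at h
  rw [HomComplex.Cocycle.toSingleMk_mem_coboundaries_iff _ _ _ _ _ 1 (by lia)] at h
  obtain ⟨g, hg⟩ := h
  have hz : Limits.IsZero (P.cochainComplex.X 1) :=
    isZero_extend_X _ _ _ (by intro j; simp; omega)
  rw [hz.eq_of_src g 0, Limits.comp_zero] at hg
  rw [← cancel_epi (P.cochainComplexXIso (-((0 : ℕ) : ℤ)) 0 rfl).hom, ← hg, Limits.comp_zero]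

theorem inj_ext (M : ModuleCat.{u} R) (n : ℕ) :
    Nonempty (((((linearCoyoneda R (ModuleCat.{u} R)).obj (.op M)).mapHomologicalComplex _).obj
      I.cocomplex).homology n ≃ₗ[R] Abelian.Ext.{u} M X n) := by
  let φ : LinearMap.ker (((((linearCoyoneda R (ModuleCat.{u} R)).obj (.op M)).mapHomologicalComplex
      _).obj I.cocomplex).d n (n + 1)).hom →ₗ[R] Abelian.Ext.{u} M X n :=
    { toFun z := I.extMk (n := n) (z.1 : M ⟶ I.cocomplex.X n) (n + 1) rfl z.2
      map_add' z w := (I.add_extMk (n := n) (z.1 : M ⟶ I.cocomplex.X n) (w.1 : M ⟶ I.cocomplex.X n)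
        (n + 1) rfl z.2 w.2).symm
      map_smul' r z := by
        obtain ⟨(f : M ⟶ I.cocomplex.X n), (hf : f ≫ I.cocomplex.d n (n + 1) = 0)⟩ := z
        have h1 := I.mk₀_comp_extMk f (n + 1) rfl hf (r • 𝟙 M)
        rw [Abelian.Ext.mk₀_smul, Abelian.Ext.smul_comp, Abelian.Ext.mk₀_id_comp] at h1
        refine Eq.trans ?_ h1.symm
        congr 1
        simp
        rfl }
  refine cc_homology _ n φ ?_ ?_ ?_
  · intro α
    obtain ⟨f, hf, rfl⟩ := I.extMk_surjective α (n + 1) rfl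
    exact ⟨⟨f, hf⟩, rfl⟩
  · intro p hp z
    exact I.extMk_eq_zero_iff _ (n + 1) rfl z.2 p hp
  · rintro rfl ⟨(f : M ⟶ I.cocomplex.X 0), (hf : f ≫ I.cocomplex.d 0 (0 + 1) = 0)⟩ h
    have h' : I.extMk f (0 + 1) rfl hf = 0 := h
    have : f = 0 := by
      exact inj_extMk_zero I f hf h'
    exact Subtype.ext this

theorem proj_ext {M : ModuleCat.{u} R} (P : ProjectiveResolution M) (X : ModuleCat.{u} R) (n : ℕ) :
    Nonempty ((P.complex.linearYonedaObj R X).homology n ≃ₗ[R] Abelian.Ext.{u} M X n) := by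
  let φ : LinearMap.ker ((P.complex.linearYonedaObj R X).d n (n + 1)).hom →ₗ[R]
      Abelian.Ext.{u} M X n :=
    { toFun z := P.extMk (n := n) (z.1 : P.complex.X n ⟶ X) (n + 1) rfl z.2
      map_add' z w := (P.add_extMk (n := n) (z.1 : P.complex.X n ⟶ X) (w.1 : P.complex.X n ⟶ X)
        (n + 1) rfl z.2 w.2).symm
      map_smul' r z := by
        obtain ⟨(f : P.complex.X n ⟶ X), (hf : P.complex.d (n + 1) n ≫ f = 0)⟩ := z
        have h1 := P.extMk_comp_mk₀ f (n + 1) rfl hf (r • 𝟙 X)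
        rw [Abelian.Ext.mk₀_smul, Abelian.Ext.comp_smul, Abelian.Ext.comp_mk₀_id] at h1
        refine Eq.trans ?_ h1.symm
        congr 1 }
  refine cc_homology _ n φ ?_ ?_ ?_
  · intro α
    obtain ⟨f, hf, rfl⟩ := P.extMk_surjective α (n + 1) rfl
    exact ⟨⟨f, hf⟩, rfl⟩
  · intro p hp z
    exact P.extMk_eq_zero_iff _ (n + 1) rfl z.2 p hp
  · rintro rfl ⟨(f : P.complex.X 0 ⟶ X), (hf : P.complex.d (0 + 1) 0 ≫ f = 0)⟩ h
    have h' : P.extMk f (0 + 1) rfl hf = 0 := h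
    have : f = 0 := by
      exact proj_extMk_zero P f hf h'
    exact Subtype.ext this

theorem extF_homology (M : ModuleCat.{u} R) (i : ℕ) :
    Nonempty (((extF I).obj (.op M)).homology i ≃ₗ[R]
      ((Ext R (ModuleCat.{u} R) i).obj (.op M)).obj X) := by
  obtain ⟨e⟩ := gF_homology (linearCoyoneda R (ModuleCat.{u} R)) I.cocomplex
    ComplexShape.embeddingUpNat (.op M) i i (by simp)
  obtain ⟨e1⟩ := inj_ext I M i
  obtain ⟨e2⟩ := proj_ext (projectiveResolution M) X i
  have e3 := ((projectiveResolution M).isoExt (R := R) i X).toLinearEquiv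
  exact ⟨e.trans (e1.trans (e2.symm.trans e3.symm))⟩

theorem koszul_iff_ext [IsNoetherianRing R] (a : Ideal R) (y : List R)
    (hy : Ideal.span {r : R | r ∈ y} = a) (X : ModuleCat.{u} R) :
    (∀ i : ℤ, Module.Finite R ((koszulTensor R X y).homology i)) ↔
      (∀ i : ℕ, Module.Finite R
        (((Ext R (ModuleCat.{u} R) i).obj (.op (ModuleCat.of R (R ⧸ a)))).obj X)) := by
  let I := injectiveResolution X
  have key := (extF_contra I).kdata.equiv a y hy
  obtain ⟨u⟩ := extF_unit I
  rw [koszulTensor_eq]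
  have q := kz_quasiIso y I.ι'
  have h1 : (∀ i : ℤ, Module.Finite R (((kz y).obj
      ((HomologicalComplex.single (ModuleCat.{u} R) (ComplexShape.up ℤ) 0).obj X)).homology i)) ↔
      ∀ i : ℤ, Module.Finite R
        (((kz y).obj ((extF I).obj (.op (ModuleCat.of R R)))).homology (-i)) := by
    have h2 (i : ℤ) : Module.Finite R (((kz y).obj
      ((HomologicalComplex.single (ModuleCat.{u} R) (ComplexShape.up ℤ) 0).obj X)).homology i) ↔
        Module.Finite R (((kz y).obj ((extF I).obj (.op (ModuleCat.of R R)))).homology i) := by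
      have e1 := (asIso (homologyMap ((kz y).map I.ι') i)).toLinearEquiv
      have e2 : ((kz y).obj ((extF I).obj (.op (ModuleCat.of R R)))).homology i ≅
        ((kz y).obj I.cochainComplex).homology i := (homologyFunctor _ _ i).mapIso ((kz y).mapIso u)
      exact Module.Finite.equiv_iff (e1.trans e2.toLinearEquiv.symm)
    constructor
    · intro h i
      exact (h2 _).1 (h _)
    · intro h i
      have := h (-i)
      rw [neg_neg] at this
      exact (h2 _).2 this
  refine h1.trans (key.trans ?_)
  change (∀ i : ℤ, Module.Finite R
    (((extF I).obj (.op (ModuleCat.of R (R ⧸ a)))).homology (-i))) ↔ _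
  constructor
  · intro h i
    obtain ⟨e⟩ := extF_homology I (ModuleCat.of R (R ⧸ a)) i
    have := h (-i)
    rw [neg_neg] at this
    exact Module.Finite.equiv e
  · intro h i
    by_cases hi : 0 < i
    · have := (extF_contra I).bdd (ModuleCat.of R (R ⧸ a)) (-i) (by omega)
      infer_instance
    · obtain ⟨j, rfl⟩ := Int.exists_eq_neg_ofNat (not_lt.1 hi)
      obtain ⟨e⟩ := extF_homology I (ModuleCat.of R (R ⧸ a)) j
      have := h j
      rw [neg_neg]
      exact Module.Finite.equiv e.symm

end ExtI

/-- Let `R` be commutative noetherian and `a` a proper ideal generated by `y₁, …, yₙ`.  For an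
`R`-module `X` the following are equivalent:  (1) all homology modules of the Koszul complex
`K(y) ⊗ X` are finitely generated; (2) `Tor^R_i(R/a, X)` is finitely generated for all `i`;
(3) `Ext^i_R(R/a, X)` is finitely generated for all `i`. -/
theorem koszul_tor_ext_finiteness_equiv
    (R : Type u) [CommRing R] (a : Ideal R) (ha : a ≠ ⊤) [IsNoetherianRing R]
    (y : List R) (hy : Ideal.span {r : R | r ∈ y} = a)
    (X : Type u) [AddCommGroup X] [Module R X] :
    ((∀ i : ℤ, Module.Finite R ((koszulTensor R (ModuleCat.of R X) y).homology i)) ↔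
      (∀ i : ℕ, Module.Finite R
        (((Tor (ModuleCat.{u} R) i).obj (ModuleCat.of R (R ⧸ a))).obj (ModuleCat.of R X)))) ∧
    ((∀ i : ℕ, Module.Finite R
        (((Tor (ModuleCat.{u} R) i).obj (ModuleCat.of R (R ⧸ a))).obj (ModuleCat.of R X))) ↔
      (∀ i : ℕ, Module.Finite R
        (((Ext R (ModuleCat.{u} R) i).obj
          (Opposite.op (ModuleCat.of R (R ⧸ a)))).obj (ModuleCat.of R X)))) := by
  have h1 := koszul_iff_tor a y hy (ModuleCat.of R X)
  have h2 := koszul_iff_ext a y hy (ModuleCat.of R X)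
  exact ⟨h1, h1.symm.trans h2⟩

end
end
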